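/- arXiv:2307.05953 — 10 statements merged into one kernel-verified Lean document; each statement's English description precedes it below -/
import Mathlib

section
/- For any probability distribution D supported on [0,∞) with CDF F and any two integers 1 ≤ a < b, the expected maximum of a i.i.d. samples divided by a is at least the expected maximum of b i.i.d. samples divided by b: E[D_{a:a}]/a ≥ E[D_{b:b}]/b, i.e. (1/a)·∫₀^∞ (1 − F(x)^a) dx ≥ (1/b)·∫₀^∞ (1 − F(x)^b) dx. -/
open MeasureTheory

/-- `emax μ k = ∫₀^∞ (1 − F(x)^k) dx`, the expected maximum of `k` i.i.d. samples from a
distribution on `[0,∞)` with law `μ` and CDF `F x = μ (Iic x)`. -/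
noncomputable def emax (μ : Measure ℝ) (k : ℕ) : ℝ :=
  ∫ x in Set.Ioi (0 : ℝ), (1 - ((μ (Set.Iic x)).toReal) ^ k)

lemma succ_mul_pow_le {t : ℝ} (h0 : 0 ≤ t) (h1 : t ≤ 1) (n : ℕ) :
    (n + 1) * t ^ n ≤ 1 + n * t ^ (n + 1) := by
  induction n with
  | zero => simp
  | succ k ih =>
    have hpow : t ^ (k + 1) ≤ 1 := pow_le_one₀ h0 h1
    have hmul := mul_le_mul_of_nonneg_left ih h0
    have hprod := mul_nonneg (sub_nonneg.2 h1) (sub_nonneg.2 hpow)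
    push_cast
    ring_nf at *
    linarith

lemma one_sub_pow_div_le {t : ℝ} (h0 : 0 ≤ t) (h1 : t ≤ 1) {a b : ℕ} (ha : 1 ≤ a) (hab : a ≤ b) :
    1 / (b : ℝ) * (1 - t ^ b) ≤ 1 / (a : ℝ) * (1 - t ^ a) := by
  induction b, hab using Nat.le_induction with
  | base => exact le_rfl
  | succ n hn ih =>
    refine le_trans ?_ ih
    have hn0 : (0 : ℝ) < n := by exact_mod_cast ha.trans hn
    have h := succ_mul_pow_le h0 h1 n
    rw [one_div_mul_eq_div, one_div_mul_eq_div, div_le_div_iff₀ (by positivity) hn0]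
    push_cast
    linarith

/-- For any distribution `D` supported on `[0,∞)` and integers `1 ≤ a < b`,
`E[D_{a:a}]/a ≥ E[D_{b:b}]/b`. -/
theorem stmt0 (μ : Measure ℝ) [IsProbabilityMeasure μ] (hsupp : μ (Set.Iio 0) = 0)
    (a b : ℕ) (ha : 1 ≤ a) (hab : a < b) :
    (1 / (b : ℝ)) * emax μ b ≤ (1 / (a : ℝ)) * emax μ a := by
  have h0 (x : ℝ) : 0 ≤ (μ (Set.Iic x)).toReal := ENNReal.toReal_nonneg
  have h1 (x : ℝ) : (μ (Set.Iic x)).toReal ≤ 1 := measureReal_le_one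
  have hmeas : Measurable fun x : ℝ => (μ (Set.Iic x)).toReal :=
    Monotone.measurable fun x y hxy =>
      ENNReal.toReal_mono (measure_ne_top μ _) (measure_mono (Set.Iic_subset_Iic.2 hxy))
  have hnonneg (k : ℕ) (x : ℝ) : 0 ≤ 1 - (μ (Set.Iic x)).toReal ^ k :=
    sub_nonneg.2 (pow_le_one₀ (h0 x) (h1 x))
  unfold emax
  by_cases hint : IntegrableOn (fun x : ℝ => 1 - (μ (Set.Iic x)).toReal ^ a) (Set.Ioi 0)
  · rw [← integral_const_mul, ← integral_const_mul]
    exact integral_mono_of_nonneg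
      (.of_forall fun x => mul_nonneg (by positivity) (hnonneg b x))
      (hint.const_mul _)
      (.of_forall fun x => one_sub_pow_div_le (h0 x) (h1 x) ha hab.le)
  · have hint' : ¬ IntegrableOn (fun x : ℝ => 1 - (μ (Set.Iic x)).toReal ^ b) (Set.Ioi 0) := by
      refine fun h => hint (Integrable.mono' h
        (measurable_const.sub (hmeas.pow_const a)).aestronglyMeasurable (.of_forall fun x => ?_))
      rw [Real.norm_of_nonneg (hnonneg a x)]
      exact sub_le_sub_left (pow_le_pow_of_le_one (h0 x) (h1 x) hab.le) 1
    rw [integral_undef hint, integral_undef hint', mul_zero, mul_zero]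
end

section
/- For any MHR distribution D on [0,∞) with finite mean and any integer n ≥ 4, if M denotes the maximum of n i.i.d. samples from D, then Pr[M ≤ 2·E[M]] ≥ 1 − n^{−3/5}. -/
open MeasureTheory

/-- The expected maximum of `n` exponential variables of rate `c`, truncated at `t`. -/
theorem integral_one_sub_one_sub_exp_pow {c : ℝ} (hc : c ≠ 0) (t : ℝ) (n : ℕ) :
    ∫ x in (0 : ℝ)..t, (1 - (1 - Real.exp (-(c * x))) ^ n) =
      c⁻¹ * ∑ k ∈ Finset.range n, (1 - Real.exp (-(c * t))) ^ (k + 1) / ((k : ℝ) + 1) := by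
  have hderiv (x : ℝ) : HasDerivAt
      (fun x : ℝ => c⁻¹ * ∑ k ∈ Finset.range n, (1 - Real.exp (-(c * x))) ^ (k + 1) / ((k : ℝ) + 1))
      (1 - (1 - Real.exp (-(c * x))) ^ n) x := by
    have hbase : HasDerivAt (fun x : ℝ => 1 - Real.exp (-(c * x)))
        (c * Real.exp (-(c * x))) x := by
      have h := (((hasDerivAt_id x).const_mul c).neg.exp).const_sub 1
      exact h.congr_deriv (by simp [mul_comm])
    have hterm (k : ℕ) : HasDerivAt
        (fun x : ℝ => (1 - Real.exp (-(c * x))) ^ (k + 1) / ((k : ℝ) + 1))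
        ((1 - Real.exp (-(c * x))) ^ k * (c * Real.exp (-(c * x)))) x := by
      have hk : (k : ℝ) + 1 ≠ 0 := by positivity
      have h := (hbase.pow (k + 1)).div_const ((k : ℝ) + 1)
      refine h.congr_deriv ?_
      push_cast [Nat.add_sub_cancel]
      field_simp
    have h := (HasDerivAt.fun_sum (u := Finset.range n) fun k _ => hterm k).const_mul c⁻¹
    refine h.congr_deriv ?_
    rw [← Finset.sum_mul, ← mul_neg_geom_sum]
    field_simp
    ring
  rw [intervalIntegral.integral_eq_sub_of_hasDerivAt (fun x _ => hderiv x)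
    (Continuous.intervalIntegrable (by fun_prop) _ _)]
  simp

theorem harmonic_sub_le_sum_pow_div {s : ℝ} (hs : s ≤ 1) (n : ℕ) :
    (harmonic n : ℝ) - n * s ≤ ∑ k ∈ Finset.range n, (1 - s) ^ (k + 1) / ((k : ℝ) + 1) := by
  have h : (harmonic n : ℝ) - n * s = ∑ k ∈ Finset.range n, (((k : ℝ) + 1)⁻¹ - s) := by
    simp [harmonic, Finset.sum_sub_distrib]
  rw [h]
  refine Finset.sum_le_sum fun k _ => ?_
  have hk : (0 : ℝ) < (k : ℝ) + 1 := by positivity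
  have hb := one_add_mul_le_pow (a := -s) (by linarith) (k + 1)
  push_cast at hb
  rw [le_div_iff₀ hk, sub_mul, inv_mul_cancel₀ hk.ne']
  calc 1 - s * ((k : ℝ) + 1) = 1 + ((k : ℝ) + 1) * -s := by ring
    _ ≤ _ := hb
    _ = _ := by ring

/-- If `G` is nonincreasing with rate `lam * G`, `lam` monotone, then `log G` is concave. -/
theorem log_le_of_monotone_hazard {G f lam : ℝ → ℝ} {x t : ℝ}
    (hx : 0 ≤ x) (hxt : x ≤ t) (hG0 : G 0 = 1) (hGpos : ∀ y ≤ t, 0 < G y)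
    (hGc : Continuous G) (hlam : Monotone lam) (hf : ∀ y ≤ t, f y = lam y * G y)
    (hG : ∀ y ∈ Set.Ioo 0 t, ContinuousAt f y → HasDerivAt G (-f y) y) :
    x * Real.log (G t) ≤ t * Real.log (G x) := by
  have key {a b : ℝ} (ha : 0 ≤ a) (hab : a ≤ b) (hb : b ≤ t) :
      ∫ y in a..b, lam y = Real.log (G a) - Real.log (G b) := by
    have hI : IntervalIntegrable lam volume a b := hlam.intervalIntegrable
    have h := integral_eq_of_hasDerivAt_off_countable_of_le
      (fun y => -Real.log (G y)) lam hab hlam.countable_not_continuousAt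
      (ContinuousOn.neg (ContinuousOn.log hGc.continuousOn
        fun y hy => (hGpos y (hy.2.trans hb)).ne')) ?_ hI
    · rw [h]; ring
    · rintro y ⟨hy, hyc⟩
      have hyc : ContinuousAt lam y := not_not.mp hyc
      have hyt : y < t := hy.2.trans_le hb
      have hfc : ContinuousAt f y := by
        refine (hyc.mul hGc.continuousAt).congr ?_
        filter_upwards [Iio_mem_nhds hyt] with z hz
        exact (hf z (le_of_lt hz)).symm
      have h := ((hG y ⟨ha.trans_lt hy.1, hyt⟩ hfc).log (hGpos y hyt.le).ne').neg
      refine h.congr_deriv ?_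
      rw [hf y hyt.le, neg_div, neg_neg, mul_div_cancel_right₀ _ (hGpos y hyt.le).ne']
  have h1 : Real.log (G 0) - Real.log (G x) ≤ x * lam x := by
    rw [← key le_rfl hx hxt]
    have h := intervalIntegral.integral_mono_on hx (hlam.intervalIntegrable (μ := volume))
      (intervalIntegrable_const (c := lam x)) fun y hy => hlam hy.2
    simpa using h
  have h2 : (t - x) * lam x ≤ Real.log (G x) - Real.log (G t) := by
    rw [← key hx hxt le_rfl]
    have h := intervalIntegral.integral_mono_on hxt (intervalIntegrable_const (c := lam x))
      (hlam.intervalIntegrable (μ := volume)) fun y hy => hlam hy.1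
    simpa using h
  rw [hG0, Real.log_one] at h1
  nlinarith [mul_le_mul_of_nonneg_left h1 (sub_nonneg.2 hxt), mul_le_mul_of_nonneg_left h2 hx]

theorem integrableOn_one_sub_cdf_pow (μ : Measure ℝ) [IsProbabilityMeasure μ]
    (hsupp : μ (Set.Iio 0) = 0) (hmean : Integrable id μ) (n : ℕ) :
    IntegrableOn (fun x => 1 - ((μ (Set.Iic x)).toReal) ^ n) (Set.Ioi 0) := by
  have hmono : Monotone fun x => (μ (Set.Iic x)).toReal := fun x y hxy =>
    measureReal_mono (Set.Iic_subset_Iic.2 hxy)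
  have htail (x : ℝ) : (μ (Set.Ioi x)).toReal = 1 - (μ (Set.Iic x)).toReal := by
    rw [← Set.compl_Iic]
    exact probReal_compl_eq_one_sub measurableSet_Iic
  have hpos : 0 ≤ᵐ[μ] (id : ℝ → ℝ) := by
    rw [Filter.EventuallyLE, ae_iff]
    simpa [Set.Iio] using hsupp
  have hint : IntegrableOn (fun x => (μ (Set.Ioi x)).toReal) (Set.Ioi 0) := by
    refine integrable_toReal_of_lintegral_ne_top ?_ ?_
    · exact Antitone.measurable (fun x y hxy => measure_mono (Set.Ioi_subset_Ioi hxy))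
        |>.aemeasurable
    · have h := lintegral_eq_lintegral_meas_lt μ hpos hmean.aemeasurable
      change _ = ∫⁻ t in Set.Ioi 0, μ (Set.Ioi t) at h
      rw [← h]
      exact hmean.lintegral_lt_top.ne
  refine (hint.const_mul (n : ℝ)).mono' ?_ (Filter.Eventually.of_forall fun x => ?_)
  · exact ((hmono.measurable.pow_const n).const_sub 1).aestronglyMeasurable
  · have h1 : (μ (Set.Iic x)).toReal ≤ 1 := measureReal_le_one
    have h0 : 0 ≤ (μ (Set.Iic x)).toReal := ENNReal.toReal_nonneg
    rw [Real.norm_of_nonneg (sub_nonneg.2 (pow_le_one₀ h0 h1)), htail]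
    have hb := one_add_mul_le_pow (a := (μ (Set.Iic x)).toReal - 1) (by linarith) n
    rw [add_sub_cancel] at hb
    linarith

theorem log_lt_harmonic_sub_rpow {n : ℕ} (hn : 4 ≤ n) :
    4 / 5 * Real.log n < (harmonic n : ℝ) - (n : ℝ) ^ (-(3 / 5 : ℝ)) := by
  have hn4 : (4 : ℝ) ≤ n := by exact_mod_cast hn
  have hγ := Real.one_half_lt_eulerMascheroniConstant.trans
    (Real.eulerMascheroniConstant_lt_eulerMascheroniSeq' n)
  rw [Real.eulerMascheroniSeq', if_neg (by omega)] at hγ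
  have hlog : 0 ≤ Real.log n := Real.log_nonneg (by linarith)
  have hpow : (n : ℝ) ^ (-(3 / 5 : ℝ)) ≤ 1 / 2 := by
    calc (n : ℝ) ^ (-(3 / 5 : ℝ)) ≤ (n : ℝ) ^ (-(1 / 2 : ℝ)) :=
          Real.rpow_le_rpow_of_exponent_le (by linarith) (by norm_num)
      _ ≤ (4 : ℝ) ^ (-(1 / 2 : ℝ)) :=
          Real.rpow_le_rpow_of_nonpos (by norm_num) hn4 (by norm_num)
      _ = 1 / 2 := by
          rw [show (4 : ℝ) = 2 ^ (2 : ℝ) by norm_num, ← Real.rpow_mul (by norm_num)]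
          norm_num [Real.rpow_neg_one]
  linarith

/-- For any MHR distribution `D` on `[0,∞)` with finite mean and any integer `n ≥ 4`, the maximum
`M` of `n` i.i.d. samples from `D` satisfies `Pr[M ≤ 2·E[M]] ≥ 1 − n^{−3/5}`.
Here `Pr[M ≤ t] = F(t)^n` and `E[M] = emax μ n`. -/
theorem stmt1 (μ : Measure ℝ) [IsProbabilityMeasure μ] (hsupp : μ (Set.Iio 0) = 0)
    (hmean : Integrable id μ)
    (f : ℝ → ℝ) (hf0 : ∀ x, 0 ≤ f x) (hfm : Measurable f)
    (hdens : μ = MeasureTheory.volume.withDensity fun x => ENNReal.ofReal (f x))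
    (hMHR : ∀ x y : ℝ, x ≤ y → (μ (Set.Iic y)).toReal < 1 →
      f x / (1 - (μ (Set.Iic x)).toReal) ≤ f y / (1 - (μ (Set.Iic y)).toReal))
    (n : ℕ) (hn : 4 ≤ n) :
    1 - (n : ℝ) ^ (-(3 / 5 : ℝ)) ≤ ((μ (Set.Iic (2 * emax μ n))).toReal) ^ n := by
  set F : ℝ → ℝ := fun x => (μ (Set.Iic x)).toReal with hF
  have hF0 (x : ℝ) : 0 ≤ F x := ENNReal.toReal_nonneg
  have hF1 (x : ℝ) : F x ≤ 1 := measureReal_le_one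
  have hFmono : Monotone F := fun x y hxy => measureReal_mono (Set.Iic_subset_Iic.2 hxy)
  have hfint : Integrable f := by
    refine (lintegral_ofReal_ne_top_iff_integrable hfm.aestronglyMeasurable
      (Filter.Eventually.of_forall hf0)).1 ?_
    have h : μ Set.univ = 1 := measure_univ
    rw [hdens, withDensity_apply _ MeasurableSet.univ, Measure.restrict_univ] at h
    simp [h]
  have hFzero : F 0 = 0 := by
    have hatom : μ {0} = 0 := by
      rw [hdens]
      exact withDensity_absolutelyContinuous _ _ (measure_singleton 0)
    have h : μ (Set.Iic 0) = 0 := by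
      rw [← Set.Iio_union_right]
      exact measure_union_null hsupp hatom
    simp [hF, h]
  have hFint (x : ℝ) : F x = ∫ y in Set.Iic x, f y := by
    rw [integral_eq_lintegral_of_nonneg_ae (Filter.Eventually.of_forall hf0)
      hfm.aestronglyMeasurable, ← withDensity_apply _ measurableSet_Iic, ← hdens]
  have hFprim (x : ℝ) : F x = ∫ y in (0 : ℝ)..x, f y := by
    rw [← intervalIntegral.integral_Iic_sub_Iic hfint.integrableOn hfint.integrableOn,
      ← hFint, ← hFint, hFzero, sub_zero]
  have hFcont : Continuous F := by
    rw [funext hFprim]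
    exact intervalIntegral.continuous_primitive (fun a b => hfint.intervalIntegrable) 0
  have hint : IntegrableOn (fun x => 1 - F x ^ n) (Set.Ioi 0) :=
    integrableOn_one_sub_cdf_pow μ hsupp hmean n
  have hnonneg (x : ℝ) : 0 ≤ 1 - F x ^ n := sub_nonneg.2 (pow_le_one₀ (hF0 x) (hF1 x))
  have hE : 0 < emax μ n := by
    refine (setIntegral_pos_iff_support_of_nonneg_ae
      (Filter.Eventually.of_forall hnonneg) hint).2 ?_
    have hnhds : ∀ᶠ x in nhds (0 : ℝ), F x < 1 :=
      hFcont.continuousAt.eventually_lt_const (by simp [hFzero])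
    obtain ⟨δ, hδ, hball⟩ := Metric.eventually_nhds_iff.1 hnhds
    refine lt_of_lt_of_le ?_ (measure_mono (s := Set.Ioo 0 δ) fun x hx => ⟨?_, hx.1⟩)
    · simpa using hδ
    · have hx1 : F x < 1 := hball (by simpa [abs_of_pos hx.1] using hx.2)
      exact (sub_pos.2 (pow_lt_one₀ (hF0 x) hx1 (by omega))).ne'
  set t : ℝ := 2 * emax μ n with ht
  have htpos : 0 < t := by positivity
  have hn4 : (4 : ℝ) ≤ n := by exact_mod_cast hn
  have hn0 : (0 : ℝ) < n := by linarith
  have hlog : 0 < Real.log n := Real.log_pos (by linarith)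
  by_contra! hcon
  change F t ^ n < _ at hcon
  set L : ℝ := 8 / 5 * Real.log n with hL
  have hLpos : 0 < L := by positivity
  have hexpL : n * Real.exp (-L) = (n : ℝ) ^ (-(3 / 5 : ℝ)) := by
    rw [Real.rpow_def_of_pos hn0]
    nth_rewrite 1 [← Real.exp_log hn0]
    rw [← Real.exp_add]
    congr 1
    rw [hL]
    ring
  have hSt : Real.exp (-L) < 1 - F t := by
    have hb := one_add_mul_le_pow (a := F t - 1) (by linarith [hF0 t]) n
    rw [add_sub_cancel] at hb
    refine lt_of_mul_lt_mul_left ?_ hn0.le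
    rw [hexpL]
    linarith
  have hFt : F t < 1 := by linarith [Real.exp_pos (-L)]
  have hlogSt : -L < Real.log (1 - F t) :=
    (Real.lt_log_iff_exp_lt (sub_pos.2 hFt)).2 hSt
  have hSpos (y : ℝ) (hy : y ≤ t) : 0 < 1 - F y := sub_pos.2 ((hFmono hy).trans_lt hFt)
  have hconc {x : ℝ} (hx : 0 ≤ x) (hxt : x ≤ t) :
      x * Real.log (1 - F t) ≤ t * Real.log (1 - F x) := by
    refine log_le_of_monotone_hazard (G := fun y => 1 - F y) (f := f)
      (lam := fun y => f (min y t) / (1 - F (min y t))) hx hxt (by simp [hFzero]) hSpos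
      (by fun_prop) ?_ ?_ ?_
    · exact fun y z hyz => hMHR _ _ (min_le_min_right t hyz)
        ((hFmono (min_le_right z t)).trans_lt hFt)
    · intro y hy
      simp only [min_eq_left hy]
      rw [div_mul_cancel₀ _ (hSpos y hy).ne']
    · intro y _ hfc
      rw [funext hFprim]
      exact (intervalIntegral.integral_hasDerivAt_right hfint.intervalIntegrable
        hfm.stronglyMeasurable.stronglyMeasurableAtFilter hfc).const_sub 1
  have hFle {x : ℝ} (hx : 0 ≤ x) (hxt : x ≤ t) : F x ≤ 1 - Real.exp (-(L / t * x)) := by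
    have h : -(L / t * x) ≤ Real.log (1 - F x) := by
      have h1 : x * -L ≤ t * Real.log (1 - F x) :=
        (mul_le_mul_of_nonneg_left hlogSt.le hx).trans (hconc hx hxt)
      rw [show -(L / t * x) = x * -L / t by ring, div_le_iff₀ htpos]
      linarith
    have := (Real.le_log_iff_exp_le (hSpos x hxt)).1 h
    linarith
  have hlower : ∫ x in (0 : ℝ)..t, (1 - (1 - Real.exp (-(L / t * x))) ^ n) ≤ emax μ n := by
    calc _ ≤ ∫ x in (0 : ℝ)..t, (1 - F x ^ n) := by
          refine intervalIntegral.integral_mono_on htpos.le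
            (Continuous.intervalIntegrable (by fun_prop) _ _)
            (Continuous.intervalIntegrable (by fun_prop) _ _) fun x hx => ?_
          exact sub_le_sub_left (pow_le_pow_left₀ (hF0 x) (hFle hx.1 hx.2) n) 1
      _ ≤ emax μ n := by
          rw [intervalIntegral.integral_of_le htpos.le]
          exact setIntegral_mono_set hint (Filter.Eventually.of_forall hnonneg)
            (Set.Ioc_subset_Ioi_self.eventuallyLE)
  rw [integral_one_sub_one_sub_exp_pow (by positivity), div_mul_cancel₀ _ htpos.ne',
    inv_div] at hlower
  have hsum := harmonic_sub_le_sum_pow_div (s := Real.exp (-L))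
    (Real.exp_le_one_iff.2 (by linarith)) n
  rw [hexpL] at hsum
  have hgt := (log_lt_harmonic_sub_rpow hn).trans_le hsum
  have h1 : t / L * (4 / 5 * Real.log n) < emax μ n :=
    (mul_lt_mul_of_pos_left hgt (by positivity)).trans_le hlower
  have h2 : t / L * (4 / 5 * Real.log n) = emax μ n := by
    rw [ht, hL]
    field_simp
    norm_num
  exact h1.ne h2
end

section
/- For any MHR distribution D on [0,∞) with finite mean and any integer n ≥ 4, the (1 − 1/n)-quantile α_n^{(D)} = inf{x : F(x) ≥ 1 − 1/n} satisfies (1/3)·E[D_{n:n}] ≤ α_n^{(D)} ≤ (5/4)·E[D_{n:n}]. -/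
open MeasureTheory

open Real Set Filter Topology ProbabilityTheory

/-- A one-step growth bound `g x * (1 + c (s - x)) ≤ g s` on an interval integrates to exponential
growth. -/
lemma mul_exp_le_of_forall_mul_le {g : ℝ → ℝ} {a b c : ℝ} (hab : a ≤ b)
    (h : ∀ x s, a ≤ x → x ≤ s → s ≤ b → g x * (1 + c * (s - x)) ≤ g s) :
    g a * exp (c * (b - a)) ≤ g b := by
  have hlim : Tendsto (fun N : ℕ => g a * (1 + c * (b - a) / N) ^ N) atTop
      (𝓝 (g a * exp (c * (b - a)))) :=
    (Real.tendsto_one_add_div_pow_exp _).const_mul _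
  have hpos : ∀ᶠ N : ℕ in atTop, (0 : ℝ) ≤ 1 + c * (b - a) / N := by
    have : Tendsto (fun N : ℕ => 1 + c * (b - a) / (N : ℝ)) atTop (𝓝 (1 + 0)) :=
      (tendsto_const_div_atTop_nhds_zero_nat _).const_add _
    exact (this.eventually (lt_mem_nhds (by norm_num : (0 : ℝ) < 1 + 0))).mono fun _ => le_of_lt
  refine le_of_tendsto hlim ?_
  filter_upwards [hpos, eventually_gt_atTop 0] with N hN hN0
  have hNR : (0 : ℝ) < N := by exact_mod_cast hN0
  have hδ : 0 ≤ (b - a) / N := div_nonneg (sub_nonneg.2 hab) hNR.le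
  have hNδ : (N : ℝ) * ((b - a) / N) = b - a := by field_simp
  have key : ∀ k : ℕ, k ≤ N →
      g a * (1 + c * (b - a) / N) ^ k ≤ g (a + k * ((b - a) / N)) := by
    intro k
    induction k with
    | zero => simp
    | succ k ih =>
      intro hk
      have hkN : ((k + 1 : ℕ) : ℝ) ≤ N := by exact_mod_cast hk
      push_cast at hkN ⊢
      have hstep := h (a + k * ((b - a) / N)) (a + (k + 1) * ((b - a) / N))
        (by nlinarith [mul_nonneg (Nat.cast_nonneg (α := ℝ) k) hδ]) (by nlinarith)
        (by nlinarith [mul_le_mul_of_nonneg_right hkN hδ])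
      calc g a * (1 + c * (b - a) / N) ^ (k + 1)
          = g a * (1 + c * (b - a) / N) ^ k * (1 + c * (b - a) / N) := by ring
        _ ≤ g (a + k * ((b - a) / N)) * (1 + c * (b - a) / N) :=
          mul_le_mul_of_nonneg_right (ih (by omega)) hN
        _ = g (a + k * ((b - a) / N)) *
            (1 + c * (a + (k + 1) * ((b - a) / N) - (a + k * ((b - a) / N)))) := by ring
        _ ≤ _ := hstep
  have := key N le_rfl
  rwa [hNδ, add_sub_cancel] at this

/-- If the hazard rate `h` of a survival function `G` is monotone, then `x ↦ -log (G x) / x` is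
nondecreasing. -/
lemma mul_log_survival_le {G h : ℝ → ℝ} (hG : Antitone G) (hG0 : G 0 = 1)
    (hh : ∀ x y, x ≤ y → 0 < G y → h x ≤ h y)
    (hlow : ∀ x s, x ≤ s → 0 < G s → h x * G s * (s - x) ≤ G x - G s)
    (hupp : ∀ x s, x ≤ s → 0 < G s → G x - G s ≤ h s * G x * (s - x))
    {m y : ℝ} (hm : 0 ≤ m) (hmy : m ≤ y) (hy : 0 < G y) :
    m * log (G y) ≤ y * log (G m) := by
  have hGm : 0 < G m := hy.trans_le (hG hmy)
  have hleft : G 0 * exp (-h m * (m - 0)) ≤ G m := by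
    refine mul_exp_le_of_forall_mul_le hm fun x s _ hxs hsm => ?_
    have hGs : 0 < G s := hGm.trans_le (hG hsm)
    have h1 := hupp x s hxs hGs
    have h2 : h s * (G x * (s - x)) ≤ h m * (G x * (s - x)) :=
      mul_le_mul_of_nonneg_right (hh s m hsm hGm)
        (mul_nonneg (hGs.trans_le (hG hxs)).le (sub_nonneg.2 hxs))
    nlinarith
  have hright : G (- -y) * exp (h m * (-m - -y)) ≤ G (- -m) := by
    refine mul_exp_le_of_forall_mul_le (g := fun t => G (-t)) (neg_le_neg hmy)
      fun x s hx hxs hs => ?_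
    have hGx : 0 < G (-x) := hy.trans_le (hG (by linarith))
    have h1 := hlow (-s) (-x) (by linarith) hGx
    have h2 : h m * (G (-x) * (s - x)) ≤ h (-s) * (G (-x) * (s - x)) :=
      mul_le_mul_of_nonneg_right (hh m (-s) (by linarith) (hGx.trans_le (hG (by linarith))))
        (mul_nonneg hGx.le (sub_nonneg.2 hxs))
    nlinarith
  rw [hG0, one_mul, sub_zero, ← le_log_iff_exp_le hGm] at hleft
  have hright' := log_le_log (by simpa using mul_pos hy (exp_pos _)) hright
  simp only [neg_neg] at hright'
  rw [log_mul hy.ne' (exp_pos _).ne', log_exp] at hright'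
  nlinarith [mul_le_mul_of_nonneg_left hright' hm, mul_nonneg (sub_nonneg.2 hmy)
    (by linarith : 0 ≤ log (G m) + h m * m)]

section Density

variable {μ : Measure ℝ} [IsProbabilityMeasure μ] {f : ℝ → ℝ}

lemma measure_Ioc_eq_ofReal_cdf_sub (x s : ℝ) :
    μ (Ioc x s) = ENNReal.ofReal (cdf μ s - cdf μ x) := by
  conv_lhs => rw [← measure_cdf μ]
  exact StieltjesFunction.measure_Ioc _ _ _

lemma mul_sub_le_cdf_sub
    (hdens : μ = volume.withDensity fun x => ENNReal.ofReal (f x))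
    {x s c : ℝ} (hxs : x ≤ s) (hc : ∀ t ∈ Ioc x s, c ≤ f t) :
    c * (s - x) ≤ cdf μ s - cdf μ x := by
  rw [← ENNReal.ofReal_le_ofReal_iff (sub_nonneg.2 (monotone_cdf μ hxs)),
    ← measure_Ioc_eq_ofReal_cdf_sub, hdens, withDensity_apply _ measurableSet_Ioc,
    ENNReal.ofReal_mul' (sub_nonneg.2 hxs), ← Real.volume_Ioc, ← setLIntegral_const]
  exact setLIntegral_mono' measurableSet_Ioc fun t ht => ENNReal.ofReal_le_ofReal (hc t ht)

lemma cdf_sub_le_mul_sub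
    (hdens : μ = volume.withDensity fun x => ENNReal.ofReal (f x))
    {x s c : ℝ} (hxs : x ≤ s) (hc0 : 0 ≤ c) (hc : ∀ t ∈ Ioc x s, f t ≤ c) :
    cdf μ s - cdf μ x ≤ c * (s - x) := by
  rw [← ENNReal.ofReal_le_ofReal_iff (mul_nonneg hc0 (sub_nonneg.2 hxs)),
    ← measure_Ioc_eq_ofReal_cdf_sub, hdens, withDensity_apply _ measurableSet_Ioc,
    ENNReal.ofReal_mul' (sub_nonneg.2 hxs), ← Real.volume_Ioc, ← setLIntegral_const]
  exact setLIntegral_mono' measurableSet_Ioc fun t ht => ENNReal.ofReal_le_ofReal (hc t ht)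

lemma cdf_eq_leftLim (hdens : μ = volume.withDensity fun x => ENNReal.ofReal (f x)) (a : ℝ) :
    cdf μ a = Function.leftLim (cdf μ) a := by
  have h0 : μ {a} = 0 := by
    rw [hdens]
    exact withDensity_absolutelyContinuous _ _ (measure_singleton a)
  rw [← measure_cdf μ, StieltjesFunction.measure_singleton, ENNReal.ofReal_eq_zero] at h0
  exact le_antisymm (by linarith) ((monotone_cdf μ).leftLim_le le_rfl)

lemma cdf_sInf_eq (hdens : μ = volume.withDensity fun x => ENNReal.ofReal (f x)) {p : ℝ}
    (hp0 : 0 < p) (hp1 : p < 1) :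
    cdf μ (sInf {x | p ≤ cdf μ x}) = p := by
  set S := {x | p ≤ cdf μ x} with hS
  have hne : S.Nonempty :=
    ((tendsto_cdf_atTop μ).eventually (lt_mem_nhds hp1)).exists.imp fun _ h => le_of_lt h
  obtain ⟨b, hb⟩ := ((tendsto_cdf_atBot μ).eventually (gt_mem_nhds hp0)).exists
  have hbdd : BddBelow S := ⟨b, fun x hx => le_of_not_gt fun hxb =>
    absurd (hx.trans (monotone_cdf μ hxb.le)) (not_le.2 hb)⟩
  refine le_antisymm ?_ ?_
  · rw [cdf_eq_leftLim hdens]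
    refine le_of_tendsto ((monotone_cdf μ).tendsto_leftLim _) ?_
    filter_upwards [self_mem_nhdsWithin] with x hx
    exact le_of_not_ge fun h => notMem_of_lt_csInf hx hbdd h
  · have hr : Tendsto (cdf μ) (𝓝[>] sInf S) (𝓝 (cdf μ (sInf S))) :=
      ((cdf μ).right_continuous _).tendsto.mono_left (nhdsWithin_mono _ Ioi_subset_Ici_self)
    refine ge_of_tendsto hr ?_
    filter_upwards [self_mem_nhdsWithin] with x hx
    obtain ⟨z, hz, hzx⟩ := exists_lt_of_csInf_lt hne hx
    exact le_trans hz (monotone_cdf μ hzx.le)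

lemma cdf_zero_eq_zero (hsupp : μ (Iio 0) = 0)
    (hdens : μ = volume.withDensity fun x => ENNReal.ofReal (f x)) : cdf μ 0 = 0 := by
  have h0 : μ {0} = 0 := by
    rw [hdens]
    exact withDensity_absolutelyContinuous _ _ (measure_singleton 0)
  have : μ (Iic 0) = 0 := by
    rw [← Iio_union_right]
    exact measure_union_null hsupp h0
  rw [cdf_eq_real, measureReal_def, this, ENNReal.toReal_zero]

/-- For a distribution with monotone hazard rate, `-log (1 - F x) / x` is nondecreasing. -/
lemma mul_log_one_sub_cdf_le (hsupp : μ (Iio 0) = 0) (hf0 : ∀ x, 0 ≤ f x)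
    (hdens : μ = volume.withDensity fun x => ENNReal.ofReal (f x))
    (hMHR : ∀ x y : ℝ, x ≤ y → cdf μ y < 1 → f x / (1 - cdf μ x) ≤ f y / (1 - cdf μ y))
    {m y : ℝ} (hm : 0 ≤ m) (hmy : m ≤ y) (hy : cdf μ y < 1) :
    m * log (1 - cdf μ y) ≤ y * log (1 - cdf μ m) := by
  have hanti : Antitone fun x => 1 - cdf μ x := fun x y hxy =>
    sub_le_sub_left (monotone_cdf μ hxy) 1
  refine mul_log_survival_le (G := fun x => 1 - cdf μ x) (h := fun x => f x / (1 - cdf μ x))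
    hanti (by simp [cdf_zero_eq_zero hsupp hdens]) (fun x y hxy h => hMHR x y hxy (by linarith)) ?_ ?_ hm hmy (by linarith)
  · intro x s hxs hs
    have hs' : cdf μ s < 1 := by linarith
    have := mul_sub_le_cdf_sub (c := f x / (1 - cdf μ x) * (1 - cdf μ s)) hdens hxs ?_
    · linarith
    intro t ht
    have hts := hanti ht.2
    have htpos : 0 < 1 - cdf μ t := hs.trans_le hts
    have hxpos : 0 < 1 - cdf μ x := hs.trans_le (hanti hxs)
    calc f x / (1 - cdf μ x) * (1 - cdf μ s) ≤ f x / (1 - cdf μ x) * (1 - cdf μ t) :=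
          mul_le_mul_of_nonneg_left hts (div_nonneg (hf0 x) hxpos.le)
      _ ≤ f t / (1 - cdf μ t) * (1 - cdf μ t) :=
          mul_le_mul_of_nonneg_right (hMHR x t ht.1.le (by linarith)) htpos.le
      _ = f t := div_mul_cancel₀ _ htpos.ne'
  · intro x s hxs hs
    have hs' : cdf μ s < 1 := by linarith
    have hxpos : 0 < 1 - cdf μ x := hs.trans_le (hanti hxs)
    have hhs : 0 ≤ f s / (1 - cdf μ s) := div_nonneg (hf0 s) hs.le
    have := cdf_sub_le_mul_sub (c := f s / (1 - cdf μ s) * (1 - cdf μ x)) hdens hxs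
      (mul_nonneg hhs hxpos.le) ?_
    · linarith
    intro t ht
    have htpos : 0 < 1 - cdf μ t := hs.trans_le (hanti ht.2)
    calc f t = f t / (1 - cdf μ t) * (1 - cdf μ t) := (div_mul_cancel₀ _ htpos.ne').symm
      _ ≤ f s / (1 - cdf μ s) * (1 - cdf μ t) :=
          mul_le_mul_of_nonneg_right (hMHR t s ht.2 hs') htpos.le
      _ ≤ f s / (1 - cdf μ s) * (1 - cdf μ x) :=
          mul_le_mul_of_nonneg_left (hanti ht.1.le) hhs

end Density

lemma one_sub_pow_le_exp {F t : ℝ} {n : ℕ} (hn : 4 ≤ n) (hF0 : 0 ≤ F)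
    (hF1 : F ≤ 1) (ht1 : 1 ≤ t → F < 1 → log (1 - F) ≤ -(t * log n)) :
    1 - F ^ n ≤ exp (1 - t) := by
  rcases lt_or_ge t 1 with ht | ht
  · exact (sub_le_self _ (pow_nonneg hF0 n)).trans (one_le_exp (by linarith))
  rcases hF1.eq_or_lt with rfl | hF
  · simpa using (exp_pos _).le
  have hn0 : (0 : ℝ) < n := by exact_mod_cast (by omega : 0 < n)
  have hL : 1 ≤ log n := by
    rw [le_log_iff_exp_le hn0]
    exact exp_one_lt_three.le.trans (by exact_mod_cast (by omega : 3 ≤ n))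
  have hbern : 1 - F ^ n ≤ n * (1 - F) := by
    have := one_add_mul_le_pow (a := F - 1) (by linarith) n
    rw [add_sub_cancel] at this
    linarith
  calc 1 - F ^ n ≤ n * (1 - F) := hbern
    _ = exp (log n + log (1 - F)) := by
      rw [exp_add, exp_log hn0, exp_log (by linarith)]
    _ ≤ exp (1 - t) := exp_le_exp.2 (by nlinarith [ht1 ht hF])

lemma pow_le_four_mul_exp {F t : ℝ} {n : ℕ} (hn : 0 < n) (hF0 : 0 ≤ F) (hF1 : F < 1)
    (ht : -(t * log n) ≤ log (1 - F)) :
    F ^ n ≤ 4 * exp (-2) * exp (-2 * log n * (1 - t)) := by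
  have hn0 : (0 : ℝ) < n := by exact_mod_cast hn
  have h1 : F ^ n ≤ exp (-(n * (1 - F))) := by
    have := pow_le_pow_left₀ hF0 (by linarith [add_one_le_exp (-(1 - F))] : F ≤ exp (-(1 - F))) n
    rwa [← exp_nat_mul, mul_neg] at this
  have h2 : exp (log n * (1 - t)) ≤ n * (1 - F) := by
    calc exp (log n * (1 - t)) ≤ exp (log n + log (1 - F)) := exp_le_exp.2 (by linarith)
      _ = n * (1 - F) := by rw [exp_add, exp_log hn0, exp_log (by linarith)]
  have h3 : 2 * (1 + log n * (1 - t) - log 2) ≤ exp (log n * (1 - t)) := by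
    have h := add_one_le_exp (log n * (1 - t) - log 2)
    rw [exp_sub, exp_log two_pos, le_div_iff₀ two_pos] at h
    linarith
  have h4 : (4 : ℝ) = exp (2 * log 2) := by
    rw [two_mul, exp_add, exp_log two_pos]; norm_num
  rw [h4, ← exp_add, ← exp_add]
  exact h1.trans (exp_le_exp.2 (by linarith))

lemma five_mul_exp_neg_two_le : 5 * exp (-2) ≤ log 2 := by
  have he : (7.3 : ℝ) ≤ exp 2 := by
    have : exp 2 = exp 1 * exp 1 := by rw [← exp_add]; norm_num
    rw [this]
    nlinarith [exp_one_gt_d9]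
  rw [exp_neg]
  have : (exp 2)⁻¹ ≤ (7.3 : ℝ)⁻¹ := inv_anti₀ (by norm_num) he
  linarith [log_two_gt_d9, (by norm_num : 5 * (7.3 : ℝ)⁻¹ ≤ 0.6931)]

lemma integral_exp_one_sub_div {a : ℝ} (ha : 0 < a) :
    IntegrableOn (fun x => exp (1 - x / a)) (Ioi 0) ∧
      ∫ x in Ioi (0 : ℝ), exp (1 - x / a) = exp 1 * a := by
  have ha' : -a⁻¹ < 0 := by simpa using ha
  have heq : (fun x => exp (1 - x / a)) = fun x => exp 1 * exp (-a⁻¹ * x) := by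
    funext x
    rw [← exp_add]
    congr 1
    ring
  rw [heq]
  refine ⟨(integrableOn_exp_mul_Ioi ha' 0).const_mul _, ?_⟩
  rw [integral_const_mul, integral_exp_mul_Ioi ha']
  simp

lemma mul_le_integral_one_sub_exp {a L : ℝ} (ha : 0 < a) (hL : 2 * log 2 ≤ L) :
    4 / 5 * a ≤ ∫ x in (0)..a, (1 - 4 * exp (-2) * exp (-2 * L * (1 - x / a))) := by
  have hlog2 : 0 < log 2 := log_pos one_lt_two
  have hL0 : 0 < L := by linarith
  have hderiv : ∀ x ∈ uIcc 0 a, HasDerivAt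
      (fun x => x - 2 * exp (-2) * a / L * exp (-2 * L * (1 - x / a)))
      (1 - 4 * exp (-2) * exp (-2 * L * (1 - x / a))) x := by
    intro x _
    have h1 : HasDerivAt (fun x => -2 * L * (1 - x / a)) (-2 * L * (-(1 / a))) x :=
      (((hasDerivAt_id x).div_const a).const_sub 1).const_mul _
    convert! (hasDerivAt_id x).sub (h1.exp.const_mul (2 * exp (-2) * a / L)) using 1
    field_simp
    ring
  rw [intervalIntegral.integral_eq_sub_of_hasDerivAt hderiv
    (Continuous.intervalIntegrable (by fun_prop) _ _)]
  have hc : 2 * exp (-2) * a / L ≤ a / 5 := by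
    rw [div_le_iff₀ hL0]
    nlinarith [five_mul_exp_neg_two_le]
  have hpos : 0 ≤ 2 * exp (-2) * a / L * exp (-2 * L * (1 - 0 / a)) := by positivity
  rw [div_self ha.ne', sub_self, mul_zero, exp_zero]
  linarith

/-- For any MHR distribution `D` on `[0,∞)` with finite mean and any integer `n ≥ 4`, the
`(1 − 1/n)`-quantile `α_n = inf {x : F(x) ≥ 1 − 1/n}` satisfies
`(1/3)·E[D_{n:n}] ≤ α_n ≤ (5/4)·E[D_{n:n}]`. -/
theorem stmt2 (μ : Measure ℝ) [IsProbabilityMeasure μ] (hsupp : μ (Set.Iio 0) = 0)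
    (hmean : Integrable id μ)
    (f : ℝ → ℝ) (hf0 : ∀ x, 0 ≤ f x) (hfm : Measurable f)
    (hdens : μ = MeasureTheory.volume.withDensity fun x => ENNReal.ofReal (f x))
    (hMHR : ∀ x y : ℝ, x ≤ y → (μ (Set.Iic y)).toReal < 1 →
      f x / (1 - (μ (Set.Iic x)).toReal) ≤ f y / (1 - (μ (Set.Iic y)).toReal))
    (n : ℕ) (hn : 4 ≤ n) :
    (1 / 3) * emax μ n ≤ sInf {x : ℝ | 1 - 1 / (n : ℝ) ≤ (μ (Set.Iic x)).toReal} ∧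
    sInf {x : ℝ | 1 - 1 / (n : ℝ) ≤ (μ (Set.Iic x)).toReal} ≤ (5 / 4) * emax μ n := by
  have hF : ∀ x, (μ (Iic x)).toReal = cdf μ x := fun x => (cdf_eq_real μ x).symm
  simp only [emax, hF] at hMHR ⊢
  have hn4 : (4 : ℝ) ≤ n := by exact_mod_cast hn
  have hn0 : (0 : ℝ) < n := by linarith
  have hinv : 1 / (n : ℝ) ≤ 1 / 4 := one_div_le_one_div_of_le (by norm_num) hn4
  have hinv0 : 0 < 1 / (n : ℝ) := by positivity
  have hα := cdf_sInf_eq hdens (p := 1 - 1 / (n : ℝ)) (by linarith) (by linarith)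
  set α := sInf {x : ℝ | 1 - 1 / (n : ℝ) ≤ cdf μ x}
  have hchord : ∀ {m y : ℝ}, 0 ≤ m → m ≤ y → cdf μ y < 1 →
      m * log (1 - cdf μ y) ≤ y * log (1 - cdf μ m) :=
    fun hm hmy hy => mul_log_one_sub_cdf_le hsupp hf0 hdens hMHR hm hmy hy
  have hα0 : 0 < α := by
    by_contra! h
    linarith [monotone_cdf μ h, cdf_zero_eq_zero hsupp hdens]
  have hlogα : log (1 - cdf μ α) = -log n := by
    rw [hα, sub_sub_cancel, one_div, log_inv]
  have hright : ∀ x, α ≤ x → cdf μ x < 1 → log (1 - cdf μ x) ≤ -(x / α * log n) := by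
    intro x hx hx1
    have := hchord hα0.le hx hx1
    rw [hlogα] at this
    rw [div_mul_eq_mul_div, ← neg_div, le_div_iff₀ hα0]
    linarith
  have hleft : ∀ x, 0 ≤ x → x ≤ α → -(x / α * log n) ≤ log (1 - cdf μ x) := by
    intro x hx0 hx
    have := hchord hx0 hx (by linarith)
    rw [hlogα] at this
    rw [div_mul_eq_mul_div, ← neg_div, div_le_iff₀ hα0]
    linarith
  have hnonneg : ∀ x, 0 ≤ 1 - cdf μ x ^ n := fun x =>
    sub_nonneg.2 (pow_le_one₀ (cdf_nonneg μ x) (cdf_le_one μ x))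
  have hbound : ∀ x, 1 - cdf μ x ^ n ≤ exp (1 - x / α) := fun x =>
    one_sub_pow_le_exp hn (cdf_nonneg μ x) (cdf_le_one μ x) fun h =>
      hright x ((one_le_div hα0).1 h)
  obtain ⟨hint, hval⟩ := integral_exp_one_sub_div hα0
  have hint' : IntegrableOn (fun x => 1 - cdf μ x ^ n) (Ioi 0) :=
    hint.mono' ((monotone_cdf μ).measurable.pow_const n |>.const_sub 1).aestronglyMeasurable
      (Eventually.of_forall fun x => by
        rw [norm_of_nonneg (hnonneg x)]
        exact hbound x)
  constructor
  · have := integral_mono hint' hint hbound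
    rw [hval] at this
    nlinarith [exp_one_lt_three]
  · have hL : 2 * log 2 ≤ log n := by
      rw [← log_rpow two_pos]
      exact log_le_log (by positivity) (by norm_num; exact hn)
    have h1 : ∫ x in Ioc 0 α, (1 - cdf μ x ^ n) ≤ ∫ x in Ioi 0, (1 - cdf μ x ^ n) :=
      setIntegral_mono_set hint' (Eventually.of_forall hnonneg)
        (Eventually.of_forall fun x hx => hx.1)
    have h2 := mul_le_integral_one_sub_exp hα0 hL
    rw [intervalIntegral.integral_of_le hα0.le] at h2
    have h3 : ∫ x in Ioc 0 α, (1 - 4 * exp (-2) * exp (-2 * log n * (1 - x / α))) ≤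
        ∫ x in Ioc 0 α, (1 - cdf μ x ^ n) := by
      refine setIntegral_mono_on ?_ (hint'.mono_set fun x hx => hx.1) measurableSet_Ioc ?_
      · exact (Continuous.integrableOn_Icc (by fun_prop)).mono_set Ioc_subset_Icc_self
      · intro x hx
        have hx1 : cdf μ x < 1 := by linarith [monotone_cdf μ hx.2]
        exact sub_le_sub_left (pow_le_four_mul_exp (by omega) (cdf_nonneg μ x) hx1
          (hleft x hx.1.le hx.2)) 1
    linarith
end

section
/- Let f_D(x) = √(2/π)·exp(−x²/2) be the density of the standard half-normal distribution, and for σ > 0 let f_{N}(t) = (1/(σ√(2π)))·exp(−t²/(2σ²)) be the density of N(0,σ²). Then for all y ∈ ℝ and all σ > 0, the posterior mean satisfies the exact identity (∫₀^∞ x·f_D(x)·f_N(y − x) dx) / (∫₀^∞ f_D(x)·f_N(y − x) dx) = y/(σ² + 1) + [φ(−y/(σ·√(σ²+1))) / (1 − Φ(−y/(σ·√(σ²+1))))] · σ/√(σ² + 1). -/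
open MeasureTheory

/-- The density of the standard half-normal distribution `|N(0,1)|` on `[0,∞)`. -/
noncomputable def fD (x : ℝ) : ℝ := Real.sqrt (2 / Real.pi) * Real.exp (-x ^ 2 / 2)

/-- The density of the normal distribution `N(0,σ²)`. -/
noncomputable def fN (σ t : ℝ) : ℝ :=
  (σ * Real.sqrt (2 * Real.pi))⁻¹ * Real.exp (-t ^ 2 / (2 * σ ^ 2))

/-- The density `φ` of the standard normal distribution. -/
noncomputable def stdNormalPDF (x : ℝ) : ℝ :=
  (Real.sqrt (2 * Real.pi))⁻¹ * Real.exp (-x ^ 2 / 2)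

/-- The CDF `Φ` of the standard normal distribution. -/
noncomputable def stdNormalCDF (x : ℝ) : ℝ := ∫ t in Set.Iic x, stdNormalPDF t

theorem stdNormalPDF_eq_gaussianPDFReal :
    stdNormalPDF = ProbabilityTheory.gaussianPDFReal 0 1 := by
  ext x
  simp [stdNormalPDF, ProbabilityTheory.gaussianPDFReal]

theorem stdNormalPDF_pos (x : ℝ) : 0 < stdNormalPDF x := by
  unfold stdNormalPDF
  positivity

theorem integrable_stdNormalPDF : Integrable stdNormalPDF := by
  rw [stdNormalPDF_eq_gaussianPDFReal]
  exact ProbabilityTheory.integrable_gaussianPDFReal 0 1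

theorem integral_Ioi_stdNormalPDF (a : ℝ) :
    ∫ u in Set.Ioi a, stdNormalPDF u = 1 - stdNormalCDF a := by
  have h : ∫ u, stdNormalPDF u = 1 := by
    rw [stdNormalPDF_eq_gaussianPDFReal]
    exact ProbabilityTheory.integral_gaussianPDFReal_eq_one 0 one_ne_zero
  rw [← h, stdNormalCDF, ← integral_add_compl measurableSet_Iic integrable_stdNormalPDF,
    Set.compl_Iic, add_sub_cancel_left]

theorem integral_Ioi_stdNormalPDF_pos (a : ℝ) : 0 < ∫ u in Set.Ioi a, stdNormalPDF u := by
  rw [setIntegral_pos_iff_support_of_nonneg_ae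
    (.of_forall fun x => (stdNormalPDF_pos x).le) integrable_stdNormalPDF.integrableOn]
  have h : Function.support stdNormalPDF = Set.univ :=
    Set.eq_univ_of_forall fun x => (stdNormalPDF_pos x).ne'
  simp [h]

theorem integrable_mul_stdNormalPDF : Integrable fun u => u * stdNormalPDF u := by
  have h := (integrable_mul_exp_neg_mul_sq (b := 1 / 2) (by norm_num)).const_mul
    (Real.sqrt (2 * Real.pi))⁻¹
  refine h.congr (.of_forall fun u => ?_)
  simp only [stdNormalPDF]
  rw [show -u ^ 2 / 2 = -(1 / 2) * u ^ 2 by ring]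
  ring

theorem hasDerivAt_neg_stdNormalPDF (x : ℝ) :
    HasDerivAt (fun u => -stdNormalPDF u) (x * stdNormalPDF x) x := by
  have h : HasDerivAt (fun u : ℝ => -u ^ 2 / 2) (-x) x := by
    refine ((hasDerivAt_pow 2 x).neg.div_const 2).congr_deriv ?_
    push_cast
    ring
  refine (h.exp.const_mul (Real.sqrt (2 * Real.pi))⁻¹).neg.congr_deriv ?_
  unfold stdNormalPDF
  ring

theorem integral_Ioi_mul_stdNormalPDF (a : ℝ) :
    ∫ u in Set.Ioi a, u * stdNormalPDF u = stdNormalPDF a := by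
  have hd (x : ℝ) (_ : x ∈ Set.Ioi a) := hasDerivAt_neg_stdNormalPDF x
  have ht := tendsto_zero_of_hasDerivAt_of_integrableOn_Ioi hd
    integrable_mul_stdNormalPDF.integrableOn integrable_stdNormalPDF.neg.integrableOn
  rw [integral_Ioi_of_hasDerivAt_of_tendsto
    (hasDerivAt_neg_stdNormalPDF a).continuousAt.continuousWithinAt hd
    integrable_mul_stdNormalPDF.integrableOn ht]
  ring

theorem integral_Ioi_zero_comp_mul_add (g : ℝ → ℝ) (a : ℝ) {b : ℝ} (hb : 0 < b) :
    ∫ x in Set.Ioi 0, g (b * x + a) = b⁻¹ * ∫ u in Set.Ioi a, g u := by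
  have h := (measurePreserving_add_right volume a).setIntegral_preimage_emb
    (measurableEmbedding_addRight a) g (Set.Ioi a)
  rw [integral_comp_mul_left_Ioi (fun x => g (x + a)) 0 hb, ← h]
  simp

theorem fD_mul_fN_eq {σ s : ℝ} (hσ : 0 < σ) (hs : 0 < s) (hs2 : s ^ 2 = σ ^ 2 + 1) (x y : ℝ) :
    fD x * fN σ (y - x) =
      fD 0 * σ⁻¹ * Real.exp (-y ^ 2 / (2 * s ^ 2)) * stdNormalPDF (s / σ * x + -y / (σ * s)) := by
  have h : Real.exp (-x ^ 2 / 2) * Real.exp (-(y - x) ^ 2 / (2 * σ ^ 2)) =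
      Real.exp (-y ^ 2 / (2 * s ^ 2)) * Real.exp (-(s / σ * x + -y / (σ * s)) ^ 2 / 2) := by
    rw [← Real.exp_add, ← Real.exp_add]
    congr 1
    field_simp
    have h4 : s ^ 4 = (σ ^ 2 + 1) ^ 2 := by rw [← hs2]; ring
    ring_nf
    simp only [h4, hs2]
    ring
  simp only [fD, fN, stdNormalPDF, mul_inv]
  norm_num
  linear_combination (√2 / √Real.pi * σ⁻¹ * ((√Real.pi)⁻¹ * (√2)⁻¹)) * h

/-- Exact formula for the posterior mean `E[X | X + ε = y]` where `X ~ |N(0,1)|` and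
`ε ~ N(0,σ²)` are independent. -/
theorem stmt5 (σ y : ℝ) (hσ : 0 < σ) :
    (∫ x in Set.Ioi (0 : ℝ), x * fD x * fN σ (y - x)) /
      (∫ x in Set.Ioi (0 : ℝ), fD x * fN σ (y - x)) =
    y / (σ ^ 2 + 1) +
      stdNormalPDF (-y / (σ * Real.sqrt (σ ^ 2 + 1))) /
          (1 - stdNormalCDF (-y / (σ * Real.sqrt (σ ^ 2 + 1)))) *
        (σ / Real.sqrt (σ ^ 2 + 1)) := by
  set s := Real.sqrt (σ ^ 2 + 1)
  have hs : 0 < s := by positivity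
  have hs2 : s ^ 2 = σ ^ 2 + 1 := Real.sq_sqrt (by positivity)
  set a := -y / (σ * s) with ha
  set K := fD 0 * σ⁻¹ * Real.exp (-y ^ 2 / (2 * s ^ 2)) with hK_def
  have hK : 0 < K := by
    unfold K fD
    positivity
  have hb : 0 < s / σ := div_pos hs hσ
  have hQ := integral_Ioi_stdNormalPDF_pos a
  have hden : ∫ x in Set.Ioi (0 : ℝ), fD x * fN σ (y - x) =
      K * ((s / σ)⁻¹ * ∫ u in Set.Ioi a, stdNormalPDF u) := by
    simp_rw [fD_mul_fN_eq hσ hs hs2]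
    rw [integral_const_mul, integral_Ioi_zero_comp_mul_add _ _ hb]
  have hnum : ∫ x in Set.Ioi (0 : ℝ), x * fD x * fN σ (y - x) =
      K * ((s / σ)⁻¹ * (σ / s * stdNormalPDF a +
        y / s ^ 2 * ∫ u in Set.Ioi a, stdNormalPDF u)) := by
    have h (x : ℝ) : x * fD x * fN σ (y - x) =
        K * (fun u => σ / s * (u * stdNormalPDF u) + y / s ^ 2 * stdNormalPDF u)
          (s / σ * x + a) := by
      have hx : x = σ / s * (s / σ * x + a) + y / s ^ 2 := by
        rw [ha]
        field_simp
        ring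
      rw [mul_assoc, fD_mul_fN_eq hσ hs hs2, ← hK_def, ← ha]
      linear_combination (K * stdNormalPDF (s / σ * x + a)) * hx
    have hsub := integral_Ioi_zero_comp_mul_add
      (fun u => σ / s * (u * stdNormalPDF u) + y / s ^ 2 * stdNormalPDF u) a hb
    beta_reduce at hsub
    simp_rw [h]
    rw [integral_const_mul, hsub,
      integral_add (integrable_mul_stdNormalPDF.integrableOn.const_mul _)
        (integrable_stdNormalPDF.integrableOn.const_mul _),
      integral_const_mul, integral_const_mul, integral_Ioi_mul_stdNormalPDF]
  rw [hnum, hden, ← integral_Ioi_stdNormalPDF, ← hs2]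
  field_simp
  ring
end

section
/- Let f_D(x) = √(2/π)·exp(−x²/2) be the density of the standard half-normal distribution, and for σ > 0 let f_N(t) = (1/(σ√(2π)))·exp(−t²/(2σ²)). Then for all y ∈ ℝ and all σ > 0, the posterior mean is upper bounded by (∫₀^∞ x·f_D(x)·f_N(y − x) dx) / (∫₀^∞ f_D(x)·f_N(y − x) dx) ≤ √(2/π) + max{0, y/(σ² + 1)}. -/
open MeasureTheory

theorem exp_quadratic_le {a : ℝ} (ha : 0 < a) (b x : ℝ) :
    Real.exp (-(a / 2) * x ^ 2 + b * x) ≤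
      Real.exp (b ^ 2 / a) * Real.exp (-(a / 4) * x ^ 2) := by
  rw [← Real.exp_add]
  apply Real.exp_le_exp.2
  have h : b ^ 2 / a + -(a / 4) * x ^ 2 - (-(a / 2) * x ^ 2 + b * x) =
      (b - a * x / 2) ^ 2 / a := by
    field_simp
    ring
  have : 0 ≤ (b - a * x / 2) ^ 2 / a := by positivity
  linarith

theorem integrable_exp_quadratic {a : ℝ} (ha : 0 < a) (b : ℝ) :
    Integrable fun x : ℝ => Real.exp (-(a / 2) * x ^ 2 + b * x) := by
  refine ((integrable_exp_neg_mul_sq (b := a / 4) (by positivity)).const_mul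
    (Real.exp (b ^ 2 / a))).mono' (by fun_prop) (.of_forall fun x => ?_)
  rw [Real.norm_of_nonneg (Real.exp_pos _).le]
  exact exp_quadratic_le ha b x

theorem integrable_mul_exp_quadratic {a : ℝ} (ha : 0 < a) (b : ℝ) :
    Integrable fun x : ℝ => x * Real.exp (-(a / 2) * x ^ 2 + b * x) := by
  refine ((integrable_mul_exp_neg_mul_sq (b := a / 4) (by positivity)).norm.const_mul
    (Real.exp (b ^ 2 / a))).mono' (by fun_prop) (.of_forall fun x => ?_)
  rw [norm_mul, norm_mul, Real.norm_of_nonneg (Real.exp_pos _).le,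
    Real.norm_of_nonneg (Real.exp_pos _).le, mul_left_comm]
  exact mul_le_mul_of_nonneg_left (exp_quadratic_le ha b x) (norm_nonneg x)

theorem tendsto_exp_quadratic {a : ℝ} (ha : 0 < a) (b : ℝ) :
    Filter.Tendsto (fun x : ℝ => Real.exp (-(a / 2) * x ^ 2 + b * x)) Filter.atTop (nhds 0) := by
  refine Real.tendsto_exp_atBot.comp ?_
  have h : Filter.Tendsto (fun x : ℝ => b + -(a / 2) * x) Filter.atTop Filter.atBot :=
    Filter.tendsto_atBot_add_const_left _ b
      (Filter.tendsto_id.const_mul_atTop_of_neg (by linarith))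
  refine (Filter.tendsto_id.atTop_mul_atBot₀ h).congr fun x => ?_
  simp only [id]
  ring

theorem integral_Ioi_mul_exp_quadratic {a : ℝ} (ha : 0 < a) (b : ℝ) :
    a * ∫ x in Set.Ioi (0 : ℝ), x * Real.exp (-(a / 2) * x ^ 2 + b * x) =
      1 + b * ∫ x in Set.Ioi (0 : ℝ), Real.exp (-(a / 2) * x ^ 2 + b * x) := by
  have hx := ((integrable_mul_exp_quadratic ha b).const_mul a).integrableOn (s := Set.Ioi (0 : ℝ))
  have hc := ((integrable_exp_quadratic ha b).const_mul b).integrableOn (s := Set.Ioi (0 : ℝ))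
  have hd : ∀ x ∈ Set.Ici (0 : ℝ),
      HasDerivAt (fun x : ℝ => Real.exp (-(a / 2) * x ^ 2 + b * x))
        (b * Real.exp (-(a / 2) * x ^ 2 + b * x) -
          a * (x * Real.exp (-(a / 2) * x ^ 2 + b * x))) x := by
    intro x _
    convert (((hasDerivAt_pow 2 x).const_mul (-(a / 2))).fun_add
      ((hasDerivAt_id' x).const_mul b)).exp using 1
    push_cast
    ring
  have h := integral_Ioi_of_hasDerivAt_of_tendsto' hd (hc.sub hx) (tendsto_exp_quadratic ha b)
  rw [integral_sub hc hx, integral_const_mul, integral_const_mul] at h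
  have h0 : Real.exp (-(a / 2) * 0 ^ 2 + b * 0) = 1 := by simp
  linarith

theorem fD_mul_fN {σ : ℝ} (hσ : 0 < σ) (y x : ℝ) :
    fD x * fN σ (y - x) =
      (Real.sqrt (2 / Real.pi) * (σ * Real.sqrt (2 * Real.pi))⁻¹ *
        Real.exp (-y ^ 2 / (2 * σ ^ 2))) *
        Real.exp (-((1 + 1 / σ ^ 2) / 2) * x ^ 2 + y / σ ^ 2 * x) := by
  unfold fD fN
  have h : Real.exp (-x ^ 2 / 2) * Real.exp (-(y - x) ^ 2 / (2 * σ ^ 2)) =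
      Real.exp (-y ^ 2 / (2 * σ ^ 2)) *
        Real.exp (-((1 + 1 / σ ^ 2) / 2) * x ^ 2 + y / σ ^ 2 * x) := by
    rw [← Real.exp_add, ← Real.exp_add]
    congr 1
    field_simp
    ring
  linear_combination Real.sqrt (2 / Real.pi) * (σ * Real.sqrt (2 * Real.pi))⁻¹ * h

/-- The mean of a Gaussian with precision `a ≥ 1` and location `b / a`, truncated to `[0,∞)`,
in a form cleared of denominators. -/
theorem integral_Ioi_mul_exp_quadratic_le {a : ℝ} (ha : 1 ≤ a) (b : ℝ) :
    ∫ x in Set.Ioi (0 : ℝ), x * Real.exp (-(a / 2) * x ^ 2 + b * x) ≤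
      (Real.sqrt (2 / Real.pi) + max 0 (b / a)) *
        ∫ x in Set.Ioi (0 : ℝ), Real.exp (-(a / 2) * x ^ 2 + b * x) := by
  have ha0 : 0 < a := by linarith
  set c := Real.sqrt (2 / Real.pi)
  have hc0 : 0 < c := by positivity
  have hint := integral_Ioi_mul_exp_quadratic ha0
  have hI (b : ℝ) := (integrable_exp_quadratic ha0 b).integrableOn (s := Set.Ioi (0 : ℝ))
  have hJ (b : ℝ) := (integrable_mul_exp_quadratic ha0 b).integrableOn (s := Set.Ioi (0 : ℝ))
  have hZ : 1 ≤ a * c * ∫ x in Set.Ioi (0 : ℝ), Real.exp (-(a / 2) * x ^ 2 + 0 * x) := by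
    simp only [zero_mul, add_zero]
    rw [integral_gaussian_Ioi, ← Real.sqrt_one]
    have h : a * c * (Real.sqrt (Real.pi / (a / 2)) / 2) = Real.sqrt a := by
      rw [eq_comm, Real.sqrt_eq_iff_mul_self_eq ha0.le (by positivity)]
      have h1 : c ^ 2 = 2 / Real.pi := Real.sq_sqrt (by positivity)
      have h2 : Real.sqrt (Real.pi / (a / 2)) ^ 2 = Real.pi / (a / 2) :=
        Real.sq_sqrt (by positivity)
      symm
      calc _ = a ^ 2 * c ^ 2 * Real.sqrt (Real.pi / (a / 2)) ^ 2 / 4 := by ring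
        _ = a := by
          rw [h1, h2]
          field_simp
          norm_num
    rw [h]
    exact Real.sqrt_le_sqrt ha
  rcases le_total 0 b with hb | hb
  · have hmono : ∫ x in Set.Ioi (0 : ℝ), Real.exp (-(a / 2) * x ^ 2 + 0 * x) ≤
        ∫ x in Set.Ioi (0 : ℝ), Real.exp (-(a / 2) * x ^ 2 + b * x) := by
      refine setIntegral_mono_on (hI 0) (hI b) measurableSet_Ioi fun x hx => ?_
      have : 0 ≤ b * x := mul_nonneg hb (le_of_lt hx)
      exact Real.exp_le_exp.2 (by linarith)
    have h1 := mul_le_mul_of_nonneg_left hmono (by positivity : 0 ≤ a * c)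
    rw [max_eq_right (by positivity)]
    refine le_of_mul_le_mul_left ?_ ha0
    rw [hint b]
    have h2 : a * (b / a) = b := mul_div_cancel₀ b ha0.ne'
    linear_combination hZ + h1 +
      (-∫ x in Set.Ioi (0 : ℝ), Real.exp (-(a / 2) * x ^ 2 + b * x)) * h2
  · rw [max_eq_left (div_nonpos_of_nonpos_of_nonneg hb ha0.le), add_zero]
    have h0 : ∫ x in Set.Ioi (0 : ℝ), x * Real.exp (-(a / 2) * x ^ 2 + 0 * x) ≤
        c * ∫ x in Set.Ioi (0 : ℝ), Real.exp (-(a / 2) * x ^ 2 + 0 * x) := by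
      refine le_of_mul_le_mul_left ?_ ha0
      rw [hint 0]
      linarith
    have hmono : ∫ x in Set.Ioi (0 : ℝ), (x * Real.exp (-(a / 2) * x ^ 2 + b * x) -
          c * Real.exp (-(a / 2) * x ^ 2 + b * x)) ≤
        ∫ x in Set.Ioi (0 : ℝ), Real.exp (b * c) * (x * Real.exp (-(a / 2) * x ^ 2 + 0 * x) -
          c * Real.exp (-(a / 2) * x ^ 2 + 0 * x)) := by
      refine setIntegral_mono_on ((hJ b).sub ((hI b).const_mul c))
        (((hJ 0).sub ((hI 0).const_mul c)).const_mul _) measurableSet_Ioi fun x _ => ?_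
      have h : (x - c) * (Real.exp (b * x) - Real.exp (b * c)) ≤ 0 := by
        rcases le_total x c with hx | hx
        · exact mul_nonpos_of_nonpos_of_nonneg (by linarith)
            (sub_nonneg.2 (Real.exp_le_exp.2 (mul_le_mul_of_nonpos_left hx hb)))
        · exact mul_nonpos_of_nonneg_of_nonpos (by linarith)
            (sub_nonpos.2 (Real.exp_le_exp.2 (mul_le_mul_of_nonpos_left hx hb)))
      have := mul_le_mul_of_nonneg_left h (Real.exp_pos (-(a / 2) * x ^ 2)).le
      rw [zero_mul, add_zero, Real.exp_add]
      linarith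
    rw [integral_const_mul, integral_sub (hJ b) ((hI b).const_mul c),
      integral_sub (hJ 0) ((hI 0).const_mul c), integral_const_mul, integral_const_mul] at hmono
    have := mul_nonpos_of_nonneg_of_nonpos (Real.exp_pos (b * c)).le (sub_nonpos.2 h0)
    linarith

/-- Upper bound on the posterior mean `E[X | X + ε = y]` where `X ~ |N(0,1)|` and `ε ~ N(0,σ²)`
are independent: `E[X | X + ε = y] ≤ √(2/π) + max {0, y/(σ²+1)}`. -/
theorem stmt6 (σ y : ℝ) (hσ : 0 < σ) :
    (∫ x in Set.Ioi (0 : ℝ), x * fD x * fN σ (y - x)) /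
      (∫ x in Set.Ioi (0 : ℝ), fD x * fN σ (y - x)) ≤
    Real.sqrt (2 / Real.pi) + max 0 (y / (σ ^ 2 + 1)) := by
  simp only [mul_assoc _ (fD _) (fN _ _), fD_mul_fN hσ]
  simp only [mul_left_comm _ (_ * Real.exp (-y ^ 2 / (2 * σ ^ 2))) (Real.exp _)]
  rw [integral_const_mul, integral_const_mul, mul_div_mul_left _ _ (by positivity)]
  have h := integral_Ioi_mul_exp_quadratic_le (a := 1 + 1 / σ ^ 2)
    (le_add_of_nonneg_right (by positivity)) (y / σ ^ 2)
  have hm : y / σ ^ 2 / (1 + 1 / σ ^ 2) = y / (σ ^ 2 + 1) := by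
    field_simp
  rw [hm] at h
  exact div_le_of_le_mul₀ (integral_nonneg fun x => (Real.exp_pos _).le) (by positivity) h
end

section
/- Let f be the probability density of a nonnegative random variable with finite mean, let σ > 0, and let f_N(t) = (1/(σ√(2π)))·exp(−t²/(2σ²)) be the density of N(0,σ²). Then the function y ↦ (∫₀^∞ x·f(x)·f_N(y − x) dx) / (∫₀^∞ f(x)·f_N(y − x) dx) is monotone nondecreasing on ℝ (whenever the denominator is positive). -/
open MeasureTheory

/-- Weighted means are monotone in the weight with respect to the likelihood ratio order. -/
theorem integral_mul_div_le_of_likelihoodRatio {μ : Measure ℝ} {f g₁ g₂ : ℝ → ℝ}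
    (hf : ∀ x, 0 ≤ f x) (hg₁ : ∀ x, 0 < g₁ x)
    (hg : ∀ a b, a ≤ b → g₁ b * g₂ a ≤ g₁ a * g₂ b)
    (i₁ : Integrable (fun x => f x * g₁ x) μ) (i₂ : Integrable (fun x => f x * g₂ x) μ)
    (j₁ : Integrable (fun x => x * f x * g₁ x) μ) (j₂ : Integrable (fun x => x * f x * g₂ x) μ)
    (hd₁ : 0 < ∫ x, f x * g₁ x ∂μ) (hd₂ : 0 < ∫ x, f x * g₂ x ∂μ) :
    (∫ x, x * f x * g₁ x ∂μ) / (∫ x, f x * g₁ x ∂μ) ≤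
      (∫ x, x * f x * g₂ x ∂μ) / (∫ x, f x * g₂ x ∂μ) := by
  set m := (∫ x, x * f x * g₁ x ∂μ) / (∫ x, f x * g₁ x ∂μ) with hm
  have hm₁ : (∫ x, x * f x * g₁ x ∂μ) - m * (∫ x, f x * g₁ x ∂μ) = 0 := by
    rw [hm, div_mul_cancel₀ _ hd₁.ne', sub_self]
  have key : ∫ x, g₂ m * (x * f x * g₁ x - m * (f x * g₁ x)) ∂μ ≤
      ∫ x, g₁ m * (x * f x * g₂ x - m * (f x * g₂ x)) ∂μ := by
    refine integral_mono ((j₁.sub (i₁.const_mul m)).const_mul _)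
      ((j₂.sub (i₂.const_mul m)).const_mul _) fun x => ?_
    have h : 0 ≤ (x - m) * (g₁ m * g₂ x - g₁ x * g₂ m) := by
      rcases le_total m x with h | h
      · exact mul_nonneg (sub_nonneg.2 h) (sub_nonneg.2 (hg m x h))
      · exact mul_nonneg_of_nonpos_of_nonpos (sub_nonpos.2 h)
          (by linarith [hg x m h])
    have := mul_nonneg (hf x) h
    dsimp only
    linarith
  rw [integral_const_mul, integral_const_mul, integral_sub j₁ (i₁.const_mul m),
    integral_sub j₂ (i₂.const_mul m), integral_const_mul, integral_const_mul, hm₁,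
    mul_zero] at key
  rw [le_div_iff₀ hd₂]
  exact sub_nonneg.1 (nonneg_of_mul_nonneg_right key (hg₁ m))

theorem fN_pos {σ : ℝ} (hσ : 0 < σ) (t : ℝ) : 0 < fN σ t := by
  unfold fN
  positivity

theorem fN_le {σ : ℝ} (hσ : 0 < σ) (t : ℝ) : fN σ t ≤ (σ * Real.sqrt (2 * Real.pi))⁻¹ := by
  unfold fN
  refine mul_le_of_le_one_right (by positivity) (Real.exp_le_one_iff.2 ?_)
  exact div_nonpos_of_nonpos_of_nonneg (neg_nonpos.2 (sq_nonneg t)) (by positivity)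

theorem continuous_fN (σ : ℝ) : Continuous (fN σ) := by
  unfold fN
  fun_prop

/-- The translates of a Gaussian density are increasing in the likelihood ratio order. -/
theorem fN_sub_mul_fN_sub_le {σ : ℝ} {y₁ y₂ a b : ℝ} (hy : y₁ ≤ y₂) (hab : a ≤ b) :
    fN σ (y₁ - b) * fN σ (y₂ - a) ≤ fN σ (y₁ - a) * fN σ (y₂ - b) := by
  unfold fN
  rw [mul_mul_mul_comm, mul_mul_mul_comm _ _ _ (Real.exp (-(y₂ - b) ^ 2 / _)), ← Real.exp_add,
    ← Real.exp_add, ← add_div, ← add_div]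
  refine mul_le_mul_of_nonneg_left (Real.exp_le_exp.2 ?_) (mul_self_nonneg _)
  refine div_le_div_of_nonneg_right ?_ (by positivity)
  nlinarith [mul_nonneg (sub_nonneg.2 hy) (sub_nonneg.2 hab)]

theorem MeasureTheory.Integrable.mul_fN_sub {μ : Measure ℝ} {h : ℝ → ℝ} (hh : Integrable h μ)
    {σ : ℝ} (hσ : 0 < σ) (y : ℝ) : Integrable (fun x => h x * fN σ (y - x)) μ := by
  refine hh.mul_bdd (c := (σ * Real.sqrt (2 * Real.pi))⁻¹)
    ((continuous_fN σ).comp (continuous_const.sub continuous_id)).aestronglyMeasurable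
    (Filter.Eventually.of_forall fun x => ?_)
  rw [Real.norm_of_nonneg (fN_pos hσ _).le]
  exact fN_le hσ _

/-- For `X` a nonnegative random variable with density `f` and finite mean, and `ε ~ N(0,σ²)`
independent of `X`, the posterior mean `y ↦ E[X | X + ε = y]` is monotone nondecreasing in `y`
(whenever the denominator is positive). -/
theorem stmt7 (f : ℝ → ℝ) (hfm : Measurable f) (hf0 : ∀ x, 0 ≤ f x)
    (hfneg : ∀ x < (0 : ℝ), f x = 0) (hf1 : (∫ x, f x) = 1)
    (hmean : Integrable fun x => x * f x)
    (σ : ℝ) (hσ : 0 < σ) (y₁ y₂ : ℝ) (hy : y₁ ≤ y₂)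
    (hd₁ : 0 < ∫ x in Set.Ioi (0 : ℝ), f x * fN σ (y₁ - x))
    (hd₂ : 0 < ∫ x in Set.Ioi (0 : ℝ), f x * fN σ (y₂ - x)) :
    (∫ x in Set.Ioi (0 : ℝ), x * f x * fN σ (y₁ - x)) /
        (∫ x in Set.Ioi (0 : ℝ), f x * fN σ (y₁ - x)) ≤
    (∫ x in Set.Ioi (0 : ℝ), x * f x * fN σ (y₂ - x)) /
        (∫ x in Set.Ioi (0 : ℝ), f x * fN σ (y₂ - x)) := by
  have hf : Integrable f := by
    by_contra h
    simp [integral_undef h] at hf1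
  exact integral_mul_div_le_of_likelihoodRatio hf0 (fun x => fN_pos hσ (y₁ - x))
    (fun _ _ hab => fN_sub_mul_fN_sub_le hy hab)
    (hf.restrict.mul_fN_sub hσ y₁) (hf.restrict.mul_fN_sub hσ y₂)
    (hmean.restrict.mul_fN_sub hσ y₁) (hmean.restrict.mul_fN_sub hσ y₂) hd₁ hd₂
end

section
/- Let Z be a nonnegative random variable supported on [0, V] for some V > 0, with law μ, let σ > 2V, and let f_N(t) = (1/(σ√(2π)))·exp(−t²/(2σ²)) be the density of N(0,σ²). Then for every y ≤ σ²/(2V), the posterior mean satisfies (∫_{[0,V]} x·f_N(y − x) dμ(x)) / (∫_{[0,V]} f_N(y − x) dμ(x)) ≤ 2·E[Z]. -/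
open MeasureTheory

/-- Two-point form of Chebyshev's association inequality: an antitone weight on `[a, b]` has
nonpositive correlation with the identity. -/
theorem integral_id_mul_le_of_antitoneOn {a b : ℝ} {μ : Measure ℝ} [IsProbabilityMeasure μ]
    (hμ : ∀ᵐ x ∂μ, x ∈ Set.Icc a b) {w : ℝ → ℝ} (hw : AntitoneOn w (Set.Icc a b))
    (hint : Integrable (fun x => x) μ) (hwint : Integrable w μ)
    (hxwint : Integrable (fun x => x * w x) μ) :
    ∫ x, x * w x ∂μ ≤ (∫ x, x ∂μ) * ∫ x, w x ∂μ := by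
  set m := ∫ x, x ∂μ with hm
  have hmem : m ∈ Set.Icc a b :=
    (convex_Icc a b).integral_mem isClosed_Icc hμ hint
  have hlin : Integrable (fun x => x * w m - m * w m) μ :=
    (hint.mul_const _).sub (integrable_const _)
  have hle : ∫ x, x * w x ∂μ ≤ ∫ x, (m * w x + (x * w m - m * w m)) ∂μ := by
    refine integral_mono_ae hxwint
      ((hwint.const_mul m).add hlin) ?_
    filter_upwards [hμ] with x hx
    rcases le_total x m with h | h
    · nlinarith [hw hx hmem h]
    · nlinarith [hw hmem hx h]
  rw [integral_add (hwint.const_mul m) hlin,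
    integral_sub (hint.mul_const _) (integrable_const _), integral_const_mul,
    integral_mul_const, ← hm] at hle
  simpa using hle

/-- A weight lying between `k` and `c * k` inflates the mean of a nonnegative variable by a factor
of at most `c`. -/
theorem integral_id_mul_le_of_bounds {μ : Measure ℝ} [IsProbabilityMeasure μ]
    (hμ : ∀ᵐ x ∂μ, 0 ≤ x) {w : ℝ → ℝ} {k c : ℝ} (hc : 0 ≤ c)
    (hlow : ∀ᵐ x ∂μ, k ≤ w x) (hupp : ∀ᵐ x ∂μ, w x ≤ c * k)
    (hint : Integrable (fun x => x) μ) (hwint : Integrable w μ)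
    (hxwint : Integrable (fun x => x * w x) μ) :
    ∫ x, x * w x ∂μ ≤ c * (∫ x, x ∂μ) * ∫ x, w x ∂μ := by
  have h0 : 0 ≤ ∫ x, x ∂μ := integral_nonneg_of_ae hμ
  have h1 : ∫ x, x * w x ∂μ ≤ (∫ x, x ∂μ) * (c * k) := by
    rw [← integral_mul_const]
    refine integral_mono_ae hxwint (hint.mul_const _) ?_
    filter_upwards [hμ, hupp] with x hx hx'
    exact mul_le_mul_of_nonneg_left hx' hx
  have h2 : k ≤ ∫ x, w x ∂μ := by
    simpa using integral_mono_ae (integrable_const k) hwint hlow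
  nlinarith [mul_le_mul_of_nonneg_left h2 (mul_nonneg hc h0)]

theorem fN_nonneg {σ : ℝ} (hσ : 0 ≤ σ) (t : ℝ) : 0 ≤ fN σ t := by
  unfold fN
  positivity

theorem fN_le_fN {σ s t : ℝ} (hσ : 0 ≤ σ) (h : t ^ 2 ≤ s ^ 2) : fN σ s ≤ fN σ t := by
  unfold fN
  gcongr

theorem exp_five_eighths_le_two : Real.exp (5 / 8) ≤ 2 := by
  rw [← Real.le_log_iff_exp_le two_pos]
  linarith [Real.log_two_gt_d9]

/-- For `Z` a nonnegative random variable with law `μ` supported on `[0,V]`, `σ > 2V`, and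
`ε ~ N(0,σ²)` independent of `Z`: for every `y ≤ σ²/(2V)`, the posterior mean satisfies
`E[Z | Z + ε = y] ≤ 2·E[Z]`. -/
theorem stmt8 (V : ℝ) (hV : 0 < V) (μ : Measure ℝ) [IsProbabilityMeasure μ]
    (hsupp : μ (Set.Icc 0 V)ᶜ = 0)
    (σ : ℝ) (hσ : 2 * V < σ) (y : ℝ) (hy : y ≤ σ ^ 2 / (2 * V)) :
    (∫ x in Set.Icc (0 : ℝ) V, x * fN σ (y - x) ∂μ) /
        (∫ x in Set.Icc (0 : ℝ) V, fN σ (y - x) ∂μ) ≤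
      2 * ∫ x, x ∂μ := by
  have hσ0 : 0 < σ := by linarith
  have hμ : ∀ᵐ x ∂μ, x ∈ Set.Icc 0 V := hsupp
  have hμ0 : ∀ᵐ x ∂μ, 0 ≤ x := hμ.mono fun x hx => hx.1
  have hrestrict : μ.restrict (Set.Icc 0 V) = μ := Measure.restrict_eq_self_of_ae_mem hμ
  have hintegrable : ∀ g : ℝ → ℝ, Continuous g → Integrable g μ := fun g hg => by
    rw [← hrestrict]
    exact hg.continuousOn.integrableOn_compact isCompact_Icc
  have hw : Continuous fun x => fN σ (y - x) := (continuous_fN σ).comp (by fun_prop)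
  have hint := hintegrable (fun x => x) continuous_id
  have hwint := hintegrable _ hw
  have hxwint := hintegrable (fun x => x * fN σ (y - x)) (continuous_id.mul hw)
  have hmean : 0 ≤ ∫ x, x ∂μ := integral_nonneg_of_ae hμ0
  have hden : 0 ≤ ∫ x, fN σ (y - x) ∂μ := integral_nonneg fun x => fN_nonneg hσ0.le _
  rw [hrestrict]
  refine div_le_of_le_mul₀ hden (by positivity) ?_
  rcases le_total y 0 with hy0 | hy0
  · have hanti : AntitoneOn (fun x => fN σ (y - x)) (Set.Icc 0 V) := fun a ha b _ hab =>
      fN_le_fN hσ0.le (by nlinarith [ha.1])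
    nlinarith [integral_id_mul_le_of_antitoneOn hμ hanti hint hwint hxwint,
      mul_nonneg hmean hden]
  · have hyV : y * (2 * V) ≤ σ ^ 2 := (le_div_iff₀ (by positivity)).mp hy
    refine integral_id_mul_le_of_bounds (k := (σ * Real.sqrt (2 * Real.pi))⁻¹ *
      Real.exp (-y ^ 2 / (2 * σ ^ 2) - 1 / 8)) hμ0 zero_le_two ?_ ?_ hint hwint hxwint
    · filter_upwards [hμ] with x hx
      unfold fN
      gcongr
      have : -(y - x) ^ 2 / (2 * σ ^ 2) - (-y ^ 2 / (2 * σ ^ 2) - 1 / 8) =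
          (2 * x * y + (σ ^ 2 / 4 - x ^ 2)) / (2 * σ ^ 2) := by
        field_simp
        ring
      have : 0 ≤ (2 * x * y + (σ ^ 2 / 4 - x ^ 2)) / (2 * σ ^ 2) := by
        have := mul_nonneg hx.1 hy0
        have : x ^ 2 ≤ σ ^ 2 / 4 := by nlinarith [hx.1, hx.2]
        apply div_nonneg <;> nlinarith
      linarith
    · filter_upwards [hμ] with x hx
      have hexp : Real.exp (-(y - x) ^ 2 / (2 * σ ^ 2)) ≤
          2 * Real.exp (-y ^ 2 / (2 * σ ^ 2) - 1 / 8) := by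
        refine le_trans ?_
          (mul_le_mul_of_nonneg_right exp_five_eighths_le_two (Real.exp_pos _).le)
        rw [← Real.exp_add, Real.exp_le_exp]
        have : 5 / 8 + (-y ^ 2 / (2 * σ ^ 2) - 1 / 8) - -(y - x) ^ 2 / (2 * σ ^ 2) =
            (σ ^ 2 - 2 * x * y + x ^ 2) / (2 * σ ^ 2) := by
          field_simp
          ring
        have : 0 ≤ (σ ^ 2 - 2 * x * y + x ^ 2) / (2 * σ ^ 2) := by
          have := mul_le_mul_of_nonneg_right hx.2 hy0
          apply div_nonneg <;> nlinarith
        linarith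
      unfold fN
      rw [mul_left_comm]
      gcongr
end

section
/- For any MHR distribution D supported on [0,∞) with finite mean, any integer n ≥ 4, any real a ≥ 1, and any integer m with n ≤ m ≤ n^a, the expected maxima satisfy E[D_{m:m}] ≤ 4a·E[D_{n:n}]. -/
open MeasureTheory

open Filter Topology in
/-- Discrete Grönwall inequality: a one-step bound `S v * (1 + l * (v - u)) ≤ S u` on `[p, q]`
integrates to exponential decay. -/
lemma mul_exp_le_of_step {S : ℝ → ℝ} {l p q : ℝ} (hpq : p ≤ q)
    (hS : ∀ u v, p ≤ u → u ≤ v → v ≤ q → S v * (1 + l * (v - u)) ≤ S u) :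
    S q * Real.exp (l * (q - p)) ≤ S p := by
  have hlim : Tendsto (fun k : ℕ => S q * (1 + l * (q - p) / k) ^ k) atTop
      (𝓝 (S q * Real.exp (l * (q - p)))) :=
    (Real.tendsto_one_add_div_pow_exp _).const_mul _
  refine le_of_tendsto hlim ?_
  have hc : Tendsto (fun k : ℕ => 1 + l * (q - p) / (k : ℝ)) atTop (𝓝 (1 + 0)) :=
    (tendsto_const_div_atTop_nhds_zero_nat _).const_add _
  rw [add_zero] at hc
  filter_upwards [hc.eventually_const_lt zero_lt_one, eventually_gt_atTop 0] with k hk hk0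
  have hkR : (0 : ℝ) < k := by exact_mod_cast hk0
  set d := (q - p) / k with hd
  have hd0 : 0 ≤ d := div_nonneg (by linarith) hkR.le
  have hkd : k * d = q - p := by rw [hd]; field_simp
  have hr : l * (q - p) / k = l * d := by rw [hd]; ring
  rw [hr] at hk ⊢
  have key : ∀ j : ℕ, j ≤ k → S (p + j * d) * (1 + l * d) ^ j ≤ S p := by
    intro j
    induction j with
    | zero => intro _; simp
    | succ j ih =>
      intro hj
      have hjk : ((j : ℝ) + 1) * d ≤ k * d := by
        gcongr
        exact_mod_cast hj
      have hstep := hS (p + j * d) (p + (j + 1) * d) (by nlinarith [show (0 : ℝ) ≤ j * d by positivity])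
        (by linarith) (by linarith)
      rw [show p + ((j : ℝ) + 1) * d - (p + j * d) = d by ring] at hstep
      push_cast
      calc S (p + (j + 1) * d) * (1 + l * d) ^ (j + 1)
          = S (p + (j + 1) * d) * (1 + l * d) * (1 + l * d) ^ j := by ring
        _ ≤ S (p + j * d) * (1 + l * d) ^ j := by gcongr
        _ ≤ S p := ih (by omega)
  have := key k le_rfl
  rwa [hkd, add_sub_cancel] at this

section MonotoneHazardRate

variable {F f : ℝ → ℝ}

/-- Beyond `t`, the survival function `1 - F` decays at least at the hazard rate of `t`. -/
lemma survival_le_of_monotone_hazard (hmono : Monotone F) (hF1 : ∀ x, F x ≤ 1)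
    (hint : ∀ u v, IntervalIntegrable f volume u v)
    (hFf : ∀ u v, F v - F u = ∫ y in u..v, f y)
    (hhaz : ∀ x y, x ≤ y → F y < 1 → f x / (1 - F x) ≤ f y / (1 - F y))
    (hf0 : ∀ x, 0 ≤ f x) {t x : ℝ} (htx : t ≤ x) :
    (1 - F x) * Real.exp (f t / (1 - F t) * (x - t)) ≤ 1 - F t := by
  rcases (hF1 x).eq_or_lt with hx | hx
  · simpa [hx] using hF1 t
  refine mul_exp_le_of_step (S := fun y => 1 - F y) htx fun u v htu huv hvx => ?_
  have hv : F v < 1 := (hmono hvx).trans_lt hx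
  have hl : 0 ≤ f t / (1 - F t) := div_nonneg (hf0 t) (sub_nonneg.2 (hF1 t))
  have h : ∫ _ in u..v, f t / (1 - F t) * (1 - F v) ≤ ∫ y in u..v, f y := by
    refine intervalIntegral.integral_mono_on huv (by simp) (hint u v) fun y hy => ?_
    have hy1 : F y < 1 := (hmono hy.2).trans_lt hv
    calc f t / (1 - F t) * (1 - F v) ≤ f t / (1 - F t) * (1 - F y) := by
          gcongr
          exact hmono hy.2
      _ ≤ f y := (le_div_iff₀ (sub_pos.2 hy1)).1 (hhaz t y (htu.trans hy.1) hy1)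
  rw [← hFf, intervalIntegral.integral_const, smul_eq_mul] at h
  linarith

/-- Up to `t`, the survival function `1 - F` decays at most at the hazard rate of `t`. -/
lemma le_survival_of_monotone_hazard (hmono : Monotone F)
    (hint : ∀ u v, IntervalIntegrable f volume u v)
    (hFf : ∀ u v, F v - F u = ∫ y in u..v, f y)
    (hhaz : ∀ x y, x ≤ y → F y < 1 → f x / (1 - F x) ≤ f y / (1 - F y))
    (hf0 : ∀ x, 0 ≤ f x) {s t : ℝ} (hst : s ≤ t) (ht : F t < 1) :
    1 - F s ≤ (1 - F t) * Real.exp (f t / (1 - F t) * (t - s)) := by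
  have hl : 0 ≤ f t / (1 - F t) := div_nonneg (hf0 t) (sub_nonneg.2 ht.le)
  have key := mul_exp_le_of_step (S := fun y => 1 - F (-y)) (l := -(f t / (1 - F t)))
    (neg_le_neg hst) fun u v htu huv hvx => ?_
  · simp only [neg_neg] at key
    rw [show -(f t / (1 - F t)) * (-s - -t) = -(f t / (1 - F t) * (t - s)) by ring,
      Real.exp_neg, ← div_eq_mul_inv, div_le_iff₀ (Real.exp_pos _)] at key
    exact key
  · have h : ∫ y in -v..-u, f y ≤ ∫ _ in -v..-u, f t / (1 - F t) * (1 - F (-v)) := by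
      refine intervalIntegral.integral_mono_on (by linarith) (hint _ _) (by simp) fun y hy => ?_
      have hyt : y ≤ t := by linarith [hy.2]
      have hy1 : F y < 1 := (hmono hyt).trans_lt ht
      calc f y ≤ f t / (1 - F t) * (1 - F y) :=
            (div_le_iff₀ (sub_pos.2 hy1)).1 (hhaz y t hyt ht)
        _ ≤ f t / (1 - F t) * (1 - F (-v)) := by
          gcongr
          exact hmono hy.1
    rw [← hFf, intervalIntegral.integral_const, smul_eq_mul] at h
    linarith

/-- If `1 - F t = 1 / n` at some `t > 0`, the tail beyond `t` is at most `n ^ (-x / t)`. -/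
lemma survival_le_exp_of_monotone_hazard (hmono : Monotone F) (hF1 : ∀ x, F x ≤ 1)
    (hint : ∀ u v, IntervalIntegrable f volume u v)
    (hFf : ∀ u v, F v - F u = ∫ y in u..v, f y)
    (hhaz : ∀ x y, x ≤ y → F y < 1 → f x / (1 - F x) ≤ f y / (1 - F y))
    (hf0 : ∀ x, 0 ≤ f x) (hF0 : F 0 = 0) {N t : ℝ} (hN : 0 < N) (ht : 0 < t)
    (htN : 1 - F t = 1 / N) {x : ℝ} (htx : t ≤ x) :
    1 - F x ≤ Real.exp (-(Real.log N / t) * x) := by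
  have hFt : F t < 1 := by linarith [one_div_pos.2 hN]
  have h1 := le_survival_of_monotone_hazard hmono hint hFf hhaz hf0 ht.le hFt
  have h2 := survival_le_of_monotone_hazard hmono hF1 hint hFf hhaz hf0 htx
  set l := f t / (1 - F t)
  rw [hF0, htN, sub_zero, sub_zero, one_div, ← div_eq_inv_mul, le_div_iff₀ hN, one_mul,
    ← Real.log_le_iff_le_exp hN, ← div_le_iff₀ ht] at h1
  have h3 : 1 - F x ≤ 1 / N * Real.exp (-(l * (x - t))) := by
    rwa [Real.exp_neg, ← div_eq_mul_inv, le_div_iff₀ (Real.exp_pos _), ← htN]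
  refine h3.trans ?_
  rw [one_div, ← Real.exp_log (inv_pos.2 hN), ← Real.exp_add, Real.log_inv, Real.exp_le_exp]
  have h4 := mul_le_mul_of_nonneg_right h1 (sub_nonneg.2 htx)
  have h5 : Real.log N / t * (x - t) = Real.log N / t * x - Real.log N := by
    field_simp
  linarith

end MonotoneHazardRate

lemma one_sub_pow_le_mul {p : ℝ} (hp : 0 ≤ p) (k : ℕ) : 1 - p ^ k ≤ k * (1 - p) := by
  have h := one_add_mul_le_pow (a := p - 1) (by linarith) k
  rw [add_sub_cancel] at h
  linarith

/-- A CDF whose tail beyond `t` is at most `N ^ (-x / t)` has integrable `1 - F ^ m` for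
`m ≤ N ^ a`, with integral at most `a * t + t`. -/
lemma integral_one_sub_pow_le {F : ℝ → ℝ} (hmono : Monotone F) (hF0 : ∀ x, 0 ≤ F x)
    (hF1 : ∀ x, F x ≤ 1) {N t a : ℝ} (ht : 0 < t) (ha : 1 ≤ a) (hN : 0 < N)
    (hlog : 1 ≤ Real.log N)
    (htail : ∀ x, t ≤ x → 1 - F x ≤ Real.exp (-(Real.log N / t) * x))
    {m : ℕ} (hm : (m : ℝ) ≤ N ^ a) :
    IntegrableOn (fun x => 1 - F x ^ m) (Set.Ioi 0) ∧
      ∫ x in Set.Ioi (0 : ℝ), (1 - F x ^ m) ≤ a * t + t := by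
  set L := Real.log N / t with hL
  have hL0 : 0 < L := div_pos (by linarith) ht
  have hat : t ≤ a * t := le_mul_of_one_le_left ht.le ha
  have hsplit : Set.Ioc 0 (a * t) ∪ Set.Ioi (a * t) = Set.Ioi (0 : ℝ) :=
    Set.Ioc_union_Ioi_eq_Ioi (ht.le.trans hat)
  have hmeas : Measurable fun x => 1 - F x ^ m := (hmono.measurable.pow_const m).const_sub 1
  have hnn : ∀ x, 0 ≤ 1 - F x ^ m := fun x => sub_nonneg.2 (pow_le_one₀ (hF0 x) (hF1 x))
  have hle1 : ∀ x, 1 - F x ^ m ≤ 1 := fun x => sub_le_self _ (pow_nonneg (hF0 x) m)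
  have hexp : IntegrableOn (fun x => m * Real.exp (-L * x)) (Set.Ioi (a * t)) :=
    (integrableOn_exp_mul_Ioi (neg_lt_zero.2 hL0) _).const_mul _
  have hbound : ∀ x ∈ Set.Ioi (a * t), 1 - F x ^ m ≤ m * Real.exp (-L * x) := fun x hx =>
    (one_sub_pow_le_mul (hF0 x) m).trans (by gcongr; exact htail x (hat.trans (le_of_lt hx)))
  have hone : IntegrableOn (fun _ : ℝ => (1 : ℝ)) (Set.Ioc 0 (a * t)) := by simp
  have hi1 : IntegrableOn (fun x => 1 - F x ^ m) (Set.Ioc 0 (a * t)) :=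
    hone.mono' hmeas.aestronglyMeasurable (.of_forall fun x => by
      rw [Real.norm_of_nonneg (hnn x)]; exact hle1 x)
  have hi2 : IntegrableOn (fun x => 1 - F x ^ m) (Set.Ioi (a * t)) :=
    hexp.mono' hmeas.aestronglyMeasurable ((ae_restrict_iff' measurableSet_Ioi).2
      (.of_forall fun x hx => by rw [Real.norm_of_nonneg (hnn x)]; exact hbound x hx))
  refine ⟨hsplit ▸ hi1.union hi2, ?_⟩
  rw [← hsplit, setIntegral_union (Set.Ioc_disjoint_Ioi le_rfl) measurableSet_Ioi hi1 hi2]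
  have b1 : ∫ x in Set.Ioc 0 (a * t), (1 - F x ^ m) ≤ a * t := by
    refine (setIntegral_mono hi1 hone hle1).trans_eq ?_
    simp [ht.le.trans hat]
  have b2 : ∫ x in Set.Ioi (a * t), (1 - F x ^ m) ≤ t := by
    refine (setIntegral_mono_on hi2 hexp measurableSet_Ioi hbound).trans ?_
    rw [integral_const_mul, integral_exp_mul_Ioi (neg_lt_zero.2 hL0), neg_div_neg_eq,
      show -L * (a * t) = -(Real.log N * a) by rw [hL]; field_simp, Real.exp_neg,
      ← Real.rpow_def_of_pos hN]
    have hNa : 0 < N ^ a := Real.rpow_pos_of_pos hN a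
    have h1 : (m : ℝ) * (N ^ a)⁻¹ ≤ 1 := by
      rwa [← div_eq_mul_inv, div_le_one hNa]
    calc (m : ℝ) * ((N ^ a)⁻¹ / L) = m * (N ^ a)⁻¹ / L := by ring
      _ ≤ 1 / L := by gcongr
      _ = t / Real.log N := by rw [hL, one_div_div]
      _ ≤ t := div_le_self ht.le hlog
  linarith

lemma one_sub_one_div_pow_le_half {n : ℕ} (hn : 1 ≤ n) : (1 - 1 / (n : ℝ)) ^ n ≤ 1 / 2 := by
  refine (Real.one_sub_div_pow_le_exp_neg (by exact_mod_cast hn)).trans ?_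
  rw [Real.exp_neg, ← one_div]
  gcongr
  linarith [Real.exp_one_gt_d9]

/-- The CDF of a measure with density is the primitive of the density. -/
lemma cdf_sub_eq_integral {μ : Measure ℝ} [IsFiniteMeasure μ] {f : ℝ → ℝ} (hf0 : ∀ x, 0 ≤ f x)
    (hfm : Measurable f) (hdens : μ = volume.withDensity fun x => ENNReal.ofReal (f x)) :
    Integrable f ∧
      ∀ u v, μ.real (Set.Iic v) - μ.real (Set.Iic u) = ∫ y in u..v, f y := by
  have hint : Integrable f := by
    refine ⟨hfm.aestronglyMeasurable, ?_⟩
    rw [hasFiniteIntegral_iff_ofReal (.of_forall hf0), ← setLIntegral_univ,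
      ← withDensity_apply _ MeasurableSet.univ, ← hdens]
    exact measure_lt_top μ _
  refine ⟨hint, fun u v => ?_⟩
  have h : ∀ x, μ.real (Set.Iic x) = ∫ y in Set.Iic x, f y := fun x => by
    rw [integral_eq_lintegral_of_nonneg_ae (.of_forall hf0) hfm.aestronglyMeasurable,
      ← withDensity_apply _ measurableSet_Iic, ← hdens, measureReal_def]
  rw [h, h, intervalIntegral.integral_Iic_sub_Iic hint.integrableOn hint.integrableOn]

/-- For any MHR distribution `D` on `[0,∞)` with finite mean, any integer `n ≥ 4`, any real
`a ≥ 1`, and any integer `m` with `n ≤ m ≤ n^a`, we have `E[D_{m:m}] ≤ 4a·E[D_{n:n}]`. -/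
theorem stmt9 (μ : Measure ℝ) [IsProbabilityMeasure μ] (hsupp : μ (Set.Iio 0) = 0)
    (hmean : Integrable id μ)
    (f : ℝ → ℝ) (hf0 : ∀ x, 0 ≤ f x) (hfm : Measurable f)
    (hdens : μ = MeasureTheory.volume.withDensity fun x => ENNReal.ofReal (f x))
    (hMHR : ∀ x y : ℝ, x ≤ y → (μ (Set.Iic y)).toReal < 1 →
      f x / (1 - (μ (Set.Iic x)).toReal) ≤ f y / (1 - (μ (Set.Iic y)).toReal))
    (n : ℕ) (hn : 4 ≤ n) (a : ℝ) (ha : 1 ≤ a)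
    (m : ℕ) (hnm : n ≤ m) (hma : (m : ℝ) ≤ (n : ℝ) ^ a) :
    emax μ m ≤ 4 * a * emax μ n := by
  obtain ⟨hint, hFf⟩ := cdf_sub_eq_integral hf0 hfm hdens
  set F : ℝ → ℝ := fun x => μ.real (Set.Iic x) with hF
  have hemax : ∀ k, emax μ k = ∫ x in Set.Ioi (0 : ℝ), (1 - F x ^ k) := fun k => rfl
  have hmono : Monotone F := fun x y hxy => measureReal_mono (Set.Iic_subset_Iic.2 hxy)
  have hFnn : ∀ x, 0 ≤ F x := fun x => measureReal_nonneg
  have hF1 : ∀ x, F x ≤ 1 := fun x => measureReal_le_one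
  have hF0 : F 0 = 0 := by
    have hsing : μ {0} = 0 := by
      rw [hdens]
      exact withDensity_absolutelyContinuous _ _ (measure_singleton 0)
    have h0 : μ (Set.Iic 0) = 0 := by
      rw [← Set.Iio_union_right]
      exact measure_union_null hsupp hsing
    simp [hF, measureReal_def, h0]
  have hFeq : ∀ x, F x = ∫ y in (0 : ℝ)..x, f y := fun x => by
    rw [← hFf 0 x]
    exact (sub_eq_self.2 hF0).symm
  have hcont : Continuous F := by
    rw [funext hFeq]
    exact intervalIntegral.continuous_primitive (fun _ _ => hint.intervalIntegrable) 0
  have hn4 : (4 : ℝ) ≤ n := by exact_mod_cast hn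
  have hn0 : (0 : ℝ) < n := by linarith
  have hninv : 1 / (n : ℝ) ≤ 1 / 4 := by gcongr
  have htop : Filter.Tendsto F Filter.atTop (nhds 1) := by
    have h := ProbabilityTheory.tendsto_cdf_atTop μ
    rwa [show (ProbabilityTheory.cdf μ : ℝ → ℝ) = F from
      funext (ProbabilityTheory.cdf_eq_real μ)] at h
  obtain ⟨b, hb, hb0⟩ := ((htop.eventually_const_lt
    (sub_lt_self 1 (one_div_pos.2 hn0))).and (Filter.eventually_ge_atTop 0)).exists
  obtain ⟨t, ⟨ht0, -⟩, htF⟩ := intermediate_value_Icc hb0 hcont.continuousOn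
    (show 1 - 1 / (n : ℝ) ∈ Set.Icc (F 0) (F b) from ⟨by rw [hF0]; linarith, hb.le⟩)
  have ht : 0 < t := by
    refine ht0.lt_of_ne fun h => ?_
    rw [← h, hF0] at htF
    linarith
  have hlog : 1 ≤ Real.log n := by
    rw [Real.le_log_iff_exp_le hn0]
    linarith [Real.exp_one_lt_d9]
  have htail : ∀ x, t ≤ x → 1 - F x ≤ Real.exp (-(Real.log n / t) * x) := fun x hx =>
    survival_le_exp_of_monotone_hazard hmono hF1 (fun _ _ => hint.intervalIntegrable) hFf hMHR
      hf0 hF0 hn0 ht (by rw [htF]; ring) hx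
  have hup := (integral_one_sub_pow_le hmono hFnn hF1 ht ha hn0 hlog htail hma).2
  have hin := (integral_one_sub_pow_le hmono hFnn hF1 ht le_rfl hn0 hlog htail
    (Real.rpow_one (n : ℝ)).ge).1
  have hlow : t / 2 ≤ ∫ x in Set.Ioi (0 : ℝ), (1 - F x ^ n) := by
    have hsub : Set.Ioc 0 t ⊆ Set.Ioi (0 : ℝ) := Set.Ioc_subset_Ioi_self
    calc t / 2 = ∫ _ in Set.Ioc 0 t, (1 / 2 : ℝ) := by
          simp [ht.le]; ring
      _ ≤ ∫ x in Set.Ioc 0 t, (1 - F x ^ n) := by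
          refine setIntegral_mono_on (by simp) (hin.mono_set hsub) measurableSet_Ioc
            fun x hx => ?_
          have h1 : F x ^ n ≤ F t ^ n := pow_le_pow_left₀ (hFnn x) (hmono hx.2) n
          rw [htF] at h1
          linarith [one_sub_one_div_pow_le_half (n := n) (by omega)]
      _ ≤ ∫ x in Set.Ioi (0 : ℝ), (1 - F x ^ n) :=
          setIntegral_mono_set hin
            (.of_forall fun x => sub_nonneg.2 (pow_le_one₀ (hFnn x) (hF1 x)))
            hsub.eventuallyLE
  rw [hemax, hemax]
  nlinarith
end

section
/- For any MHR distribution D supported on [0,∞) with finite mean and any integer n ≥ 1, the expected maximum of n i.i.d. samples satisfies E[D_{n:n}] ≤ (ln n + 1)·E[D]. -/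
open MeasureTheory

open Set ProbabilityTheory Filter

/-- Chebyshev's integral inequality for functions varying in opposite directions
a.e. -/
lemma integral_mul_le_of_antivary_ae {α : Type*} [MeasurableSpace α] {μ : Measure α}
    [IsProbabilityMeasure μ] {g φ : α → ℝ} (hg : Integrable g μ) (hφ : Integrable φ μ)
    (hgφ : Integrable (fun x => g x * φ x) μ)
    (h : ∀ᵐ p ∂μ.prod μ, (g p.1 - g p.2) * (φ p.1 - φ p.2) ≤ 0) :
    ∫ x, g x * φ x ∂μ ≤ (∫ x, g x ∂μ) * ∫ x, φ x ∂μ := by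
  have i1 : Integrable (fun p : α × α => g p.1 * φ p.1) (μ.prod μ) := hgφ.comp_fst μ
  have i2 : Integrable (fun p : α × α => g p.2 * φ p.2) (μ.prod μ) := hgφ.comp_snd μ
  have i3 : Integrable (fun p : α × α => g p.1 * φ p.2) (μ.prod μ) := hg.mul_prod hφ
  have i4 : Integrable (fun p : α × α => φ p.1 * g p.2) (μ.prod μ) := hφ.mul_prod hg
  have e1 : ∫ p : α × α, g p.1 * φ p.1 ∂μ.prod μ = ∫ x, g x * φ x ∂μ := by
    simpa using integral_fun_fst (μ := μ) (ν := μ) (fun x => g x * φ x)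
  have e2 : ∫ p : α × α, g p.2 * φ p.2 ∂μ.prod μ = ∫ x, g x * φ x ∂μ := by
    simpa using integral_fun_snd (μ := μ) (ν := μ) (fun x => g x * φ x)
  have e3 := integral_prod_mul (μ := μ) (ν := μ) g φ
  have e4 := integral_prod_mul (μ := μ) (ν := μ) φ g
  have key : ∫ p : α × α, ((g p.1 * φ p.1 + g p.2 * φ p.2) - (g p.1 * φ p.2 + φ p.1 * g p.2))
      ∂μ.prod μ ≤ 0 := by
    refine integral_nonpos_of_ae ?_
    filter_upwards [h] with p hp
    simp only [Pi.zero_apply]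
    linarith
  rw [integral_sub (by exact i1.add i2) (by exact i3.add i4), integral_add i1 i2,
    integral_add i3 i4,
    e1, e2, e3, e4] at key
  linarith

lemma measureReal_Iic_mono (μ : Measure ℝ) [IsProbabilityMeasure μ] :
    Monotone fun x => μ.real (Iic x) :=
  fun _ _ h => measureReal_mono (Iic_subset_Iic.2 h)

lemma continuous_cdf_of_nullSingleton (μ : Measure ℝ) [IsProbabilityMeasure μ]
    [NullSingletonClass μ] :
    Continuous (cdf μ) := by
  refine continuous_iff_continuousAt.2 fun a => ?_
  rw [(monotone_cdf μ).continuousAt_iff_leftLim_eq_rightLim, StieltjesFunction.rightLim_eq]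
  have h : (cdf μ).measure {a} = 0 := by rw [measure_cdf]; simp
  rw [StieltjesFunction.measure_singleton, ENNReal.ofReal_eq_zero] at h
  exact le_antisymm ((monotone_cdf μ).leftLim_le le_rfl) (by linarith)

lemma exists_measureReal_Iic_eq (μ : Measure ℝ) [IsProbabilityMeasure μ]
    [NullSingletonClass μ] {s : ℝ}
    (h0 : 0 < s) (h1 : s < 1) : ∃ b, μ.real (Iic b) = s := by
  obtain ⟨b, hb⟩ := mem_range_of_exists_le_of_exists_ge (continuous_cdf_of_nullSingleton μ)
    (((tendsto_cdf_atBot μ).eventually_le_const h0).exists)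
    (((tendsto_cdf_atTop μ).eventually_const_le h1).exists)
  exact ⟨b, by rw [← cdf_eq_real, hb]⟩

/-- The probability integral transform: an atomless law is pushed to the uniform law by its CDF. -/
lemma map_measureReal_Iic (μ : Measure ℝ) [IsProbabilityMeasure μ]
    [NullSingletonClass μ] :
    μ.map (fun x => μ.real (Iic x)) = volume.restrict (Ioc 0 1) := by
  have hm := (measureReal_Iic_mono μ).measurable
  have : IsProbabilityMeasure (μ.map fun x => μ.real (Iic x)) :=
    Measure.isProbabilityMeasure_map hm.aemeasurable
  refine Measure.ext_of_Iic _ _ fun s => ?_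
  rw [Measure.map_apply hm measurableSet_Iic, Measure.restrict_apply measurableSet_Iic,
    inter_comm, Ioc_inter_Iic, Real.volume_Ioc, sub_zero]
  rcases le_or_gt 1 s with hs | hs
  · have : (fun x => μ.real (Iic x)) ⁻¹' Iic s = univ :=
      eq_univ_of_forall fun x => measureReal_le_one.trans hs
    simp [this, hs]
  rw [min_eq_right hs.le, ← ofReal_measureReal]
  rcases lt_or_ge s 0 with hs0 | hs0
  · have : (fun x => μ.real (Iic x)) ⁻¹' Iic s = ∅ :=
      eq_empty_of_forall_notMem fun x hx => absurd (measureReal_nonneg (μ := μ) (s := Iic x))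
        (not_le.2 (lt_of_le_of_lt hx hs0))
    simp [this, hs0.le]
  congr 1
  refine le_antisymm (le_of_forall_gt_imp_ge_of_dense fun t ht => ?_) ?_
  · rcases le_or_gt 1 t with h1 | h1
    · exact measureReal_le_one.trans h1
    obtain ⟨b, hb⟩ := exists_measureReal_Iic_eq μ (hs0.trans_lt ht) h1
    rw [← hb]
    refine measureReal_mono fun x hx => ?_
    by_contra hxb
    have h2 := measureReal_Iic_mono μ (not_le.1 hxb).le
    simp only [mem_preimage, mem_Iic] at hx h2
    linarith
  · rcases hs0.eq_or_lt with rfl | h0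
    · exact measureReal_nonneg
    obtain ⟨b, hb⟩ := exists_measureReal_Iic_eq μ h0 hs
    conv_lhs => rw [← hb]
    exact measureReal_mono fun x hx => (measureReal_Iic_mono μ hx).trans hb.le

lemma integral_measureReal_Iic_pow (μ : Measure ℝ) [IsProbabilityMeasure μ]
    [NullSingletonClass μ] (m : ℕ) :
    ∫ x, μ.real (Iic x) ^ m ∂μ = 1 / (m + 1) := by
  have h := integral_map (μ := μ) (measureReal_Iic_mono μ).measurable.aemeasurable
    (f := fun y : ℝ => y ^ m) (by fun_prop)
  rw [← h, map_measureReal_Iic, ← intervalIntegral.integral_of_le zero_le_one, integral_pow]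
  simp

/-- For a monotone hazard rate law, `E[max of m + 1 samples] - E[max of m samples]` is at most
`E[D] / (m + 1)`. -/
lemma integral_pow_mul_one_sub_le_of_mhr (μ : Measure ℝ) [IsProbabilityMeasure μ]
    (hsupp : μ (Iio 0) = 0) {f : ℝ → ℝ} (hf0 : ∀ x, 0 ≤ f x) (hfm : Measurable f)
    (hdens : μ = volume.withDensity fun x => ENNReal.ofReal (f x))
    (hMHR : ∀ x y : ℝ, x ≤ y → μ.real (Iic y) < 1 →
      f x / (1 - μ.real (Iic x)) ≤ f y / (1 - μ.real (Iic y)))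
    (hint : IntegrableOn (fun x => 1 - μ.real (Iic x)) (Ioi 0)) (m : ℕ) :
    ∫ x in Ioi (0 : ℝ), μ.real (Iic x) ^ m * (1 - μ.real (Iic x)) ≤
      1 / (m + 1) * ∫ x in Ioi (0 : ℝ), (1 - μ.real (Iic x)) := by
  rcases Nat.eq_zero_or_pos m with rfl | hm
  · simp
  have hna : NullSingletonClass μ := by
    rw [hdens]
    exact ⟨fun x => withDensity_absolutelyContinuous _ _ (measure_singleton x)⟩
  have hd : Measurable fun x => ENNReal.ofReal (f x) := hfm.ennreal_ofReal
  set F : ℝ → ℝ := fun x => μ.real (Iic x) with hF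
  have hmono : Monotone F := measureReal_Iic_mono μ
  have hF0 : ∀ x, 0 ≤ F x := fun x => measureReal_nonneg
  have hF1 : ∀ x, F x ≤ 1 := fun x => measureReal_le_one
  change ∫ x in Ioi (0 : ℝ), F x ^ m * (1 - F x) ≤ 1 / (m + 1) * ∫ x in Ioi (0 : ℝ), (1 - F x)
  change ∀ x y : ℝ, x ≤ y → F y < 1 → f x / (1 - F x) ≤ f y / (1 - F y) at hMHR
  change IntegrableOn (fun x => 1 - F x) (Ioi 0) at hint
  set ν : Measure ℝ := volume.restrict (Ioi 0) with hν
  have hμν : μ = ν.withDensity fun x => ENNReal.ofReal (f x) := by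
    rw [hν, ← restrict_withDensity measurableSet_Ioi, ← hdens]
    refine (Measure.restrict_eq_self_of_ae_mem ?_).symm
    have : μ (Iic 0) = 0 := by rw [← Iio_union_right, measure_union_null hsupp (by simp)]
    rw [ae_iff]
    simpa [Iic] using this
  have htop : ∀ᵐ x ∂ν, ENNReal.ofReal (f x) < ⊤ := by simp
  have hzero : ∀ x, f x = 0 → F x < 1 → F x = 0 := by
    intro x hx hx1
    have h0 : ∀ y ≤ x, f y = 0 := by
      intro y hy
      have h1 := hMHR y x hy hx1
      rw [hx, zero_div] at h1
      have h2 := hmono hy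
      exact le_antisymm (nonpos_of_mul_nonpos_left (by rwa [div_eq_mul_inv] at h1)
        (inv_pos.2 (by linarith))) (hf0 y)
    have : μ (Iic x) = 0 := by
      rw [hdens, withDensity_apply _ measurableSet_Iic,
        setLIntegral_congr_fun (g := fun _ => 0) measurableSet_Iic
          (fun y hy => by simp [h0 y hy])]
      simp
    simp [hF, measureReal_def, this]
  set φ : ℝ → ℝ := fun x => (1 - F x) / f x with hφdef
  have hφm : Measurable φ := (measurable_const.sub hmono.measurable).div hfm
  have hfφ : ∀ x, f x * φ x ≤ 1 - F x := fun x => by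
    rcases (hf0 x).eq_or_lt with h | h
    · rw [← h, zero_mul]; linarith [hF1 x]
    · exact (mul_div_cancel₀ _ h.ne').le
  have hfφ0 : ∀ x, 0 ≤ f x * φ x := fun x =>
    mul_nonneg (hf0 x) (div_nonneg (by linarith [hF1 x]) (hf0 x))
  have hfφi : Integrable (fun x => f x * φ x) ν := by
    refine Integrable.mono' hint (hfm.mul hφm).aestronglyMeasurable (ae_of_all _ fun x => ?_)
    rw [Real.norm_of_nonneg (hfφ0 x)]
    exact hfφ x
  have hφi : Integrable φ μ := by
    rw [hμν, integrable_withDensity_iff_integrable_smul' hd htop]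
    simpa [ENNReal.toReal_ofReal, hf0] using hfφi
  have hFm : Measurable fun x => F x ^ m := hmono.measurable.pow_const m
  have hFb : ∀ x, ‖F x ^ m‖ ≤ 1 := fun x => by
    rw [Real.norm_of_nonneg (pow_nonneg (hF0 x) m)]
    exact pow_le_one₀ (hF0 x) (hF1 x)
  have hFi : Integrable (fun x => F x ^ m) μ :=
    Integrable.of_bound hFm.aestronglyMeasurable 1 (ae_of_all _ hFb)
  have hFφi : Integrable (fun x => F x ^ m * φ x) μ :=
    hφi.bdd_mul hFm.aestronglyMeasurable (ae_of_all _ hFb)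
  have hpos : ∀ᵐ x ∂μ, 0 < f x := by
    rw [hdens, ae_withDensity_iff hd]
    exact ae_of_all _ fun x hx => by simpa using hx
  have hanti : ∀ x y, x ≤ y → 0 < f x → 0 < f y → φ y ≤ φ x := by
    intro x y hxy hx hy
    rcases (hF1 y).eq_or_lt with h | h
    · simp only [hφdef, h, sub_self, zero_div]
      exact div_nonneg (by linarith [hF1 x]) (hf0 x)
    · have hlt : F x < 1 := (hmono hxy).trans_lt h
      have := hMHR x y hxy h
      simp only [hφdef]
      rw [div_le_div_iff₀ (by linarith) (by linarith)] at this
      rw [div_le_div_iff₀ hy hx]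
      linarith
  have hcheb := integral_mul_le_of_antivary_ae hFi hφi hFφi (by
    filter_upwards [Measure.quasiMeasurePreserving_fst.ae hpos,
      Measure.quasiMeasurePreserving_snd.ae hpos] with p h1 h2
    rcases le_total p.1 p.2 with h | h
    · exact mul_nonpos_of_nonpos_of_nonneg
        (sub_nonpos.2 (pow_le_pow_left₀ (hF0 _) (hmono h) m))
        (sub_nonneg.2 (hanti _ _ h h1 h2))
    · exact mul_nonpos_of_nonneg_of_nonpos
        (sub_nonneg.2 (pow_le_pow_left₀ (hF0 _) (hmono h) m))
        (sub_nonpos.2 (hanti _ _ h h2 h1)))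
  have hleft : ∫ x, F x ^ m * φ x ∂μ = ∫ x, F x ^ m * (1 - F x) ∂ν := by
    conv_lhs => rw [hμν]
    rw [integral_withDensity_eq_integral_toReal_smul hd htop]
    refine integral_congr_ae (ae_of_all _ fun x => ?_)
    simp only [smul_eq_mul, ENNReal.toReal_ofReal (hf0 x), hφdef]
    rcases (hf0 x).eq_or_lt with h | h
    · rcases (hF1 x).eq_or_lt with h1 | h1
      · simp [h1]
      · simp [← h, hzero x h.symm h1, hm.ne']
    · field_simp
  have hright : ∫ x, φ x ∂μ ≤ ∫ x, (1 - F x) ∂ν := by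
    conv_lhs => rw [hμν]
    rw [integral_withDensity_eq_integral_toReal_smul hd htop]
    simp only [smul_eq_mul, ENNReal.toReal_ofReal (hf0 _)]
    exact integral_mono hfφi hint hfφ
  rw [← hleft]
  refine hcheb.trans ?_
  rw [show ∫ x, F x ^ m ∂μ = 1 / (m + 1) from integral_measureReal_Iic_pow μ m]
  exact mul_le_mul_of_nonneg_left hright (by positivity)

lemma one_sub_measureReal_Iic (μ : Measure ℝ) [IsProbabilityMeasure μ] (x : ℝ) :
    1 - μ.real (Iic x) = μ.real {a | x < a} := by
  have := probReal_compl_eq_one_sub (μ := μ) (s := Iic x) measurableSet_Iic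
  rw [compl_Iic] at this
  exact this.symm

/-- The survival function of an integrable law on `[0,∞)` is integrable on `(0,∞)`. -/
lemma integrableOn_one_sub_measureReal_Iic (μ : Measure ℝ) [IsProbabilityMeasure μ]
    (hnonneg : 0 ≤ᵐ[μ] id) (hmean : Integrable id μ) :
    IntegrableOn (fun x => 1 - μ.real (Iic x)) (Ioi 0) := by
  have h := lintegral_eq_lintegral_meas_lt μ hnonneg hmean.aemeasurable
  have hfin := hmean.lintegral_lt_top
  simp_rw [one_sub_measureReal_Iic μ]
  refine ⟨?_, ?_⟩
  · have : Antitone fun x => μ.real {a | x < a} := fun x y hxy =>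
      measureReal_mono fun a ha => lt_of_le_of_lt hxy ha
    exact this.measurable.aestronglyMeasurable
  · rw [hasFiniteIntegral_iff_ofReal (ae_of_all _ fun x => measureReal_nonneg)]
    rw [lintegral_congr fun x => ofReal_measureReal (measure_ne_top μ _)]
    exact h ▸ hfin

/-- For any MHR distribution `D` on `[0,∞)` with finite mean and any integer `n ≥ 1`,
`E[D_{n:n}] ≤ (ln n + 1)·E[D]`. -/
theorem stmt10 (μ : Measure ℝ) [IsProbabilityMeasure μ] (hsupp : μ (Set.Iio 0) = 0)
    (hmean : Integrable id μ)
    (f : ℝ → ℝ) (hf0 : ∀ x, 0 ≤ f x) (hfm : Measurable f)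
    (hdens : μ = MeasureTheory.volume.withDensity fun x => ENNReal.ofReal (f x))
    (hMHR : ∀ x y : ℝ, x ≤ y → (μ (Set.Iic y)).toReal < 1 →
      f x / (1 - (μ (Set.Iic x)).toReal) ≤ f y / (1 - (μ (Set.Iic y)).toReal))
    (n : ℕ) (hn : 1 ≤ n) :
    emax μ n ≤ (Real.log n + 1) * ∫ x, x ∂μ := by
  have hnonneg : 0 ≤ᵐ[μ] id := by
    rw [EventuallyLE, ae_iff]
    simpa [Iio] using hsupp
  have hint := integrableOn_one_sub_measureReal_Iic μ hnonneg hmean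
  have hE : ∫ x, x ∂μ = ∫ x in Ioi (0 : ℝ), (1 - μ.real (Iic x)) := by
    simp_rw [one_sub_measureReal_Iic μ]
    exact hmean.integral_eq_integral_meas_lt hnonneg
  have hi : ∀ m : ℕ, Integrable (fun x => μ.real (Iic x) ^ m * (1 - μ.real (Iic x)))
      (volume.restrict (Ioi 0)) := fun m =>
    hint.bdd_mul (c := 1) ((measureReal_Iic_mono μ).measurable.pow_const m).aestronglyMeasurable
      (ae_of_all _ fun x => by
        rw [Real.norm_of_nonneg (pow_nonneg measureReal_nonneg m)]
        exact pow_le_one₀ measureReal_nonneg measureReal_le_one)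
  have hsum : emax μ n =
      ∑ m ∈ Finset.range n, ∫ x in Ioi (0 : ℝ), μ.real (Iic x) ^ m * (1 - μ.real (Iic x)) := by
    rw [← integral_finsetSum _ fun m _ => hi m, emax]
    simp only [← Finset.sum_mul, geom_sum_mul_neg, measureReal_def]
  have hharm : ∑ m ∈ Finset.range n, (1 / ((m : ℝ) + 1)) ≤ Real.log n + 1 := by
    have h := harmonic_le_one_add_log n
    simp only [harmonic, Rat.cast_sum] at h
    push_cast at h
    simp only [one_div]
    linarith
  rw [hsum]
  calc _ ≤ ∑ m ∈ Finset.range n, 1 / ((m : ℝ) + 1) * ∫ x, x ∂μ := by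
        rw [hE]
        exact Finset.sum_le_sum fun m _ =>
          integral_pow_mul_one_sub_le_of_mhr μ hsupp hf0 hfm hdens hMHR hint m
    _ = (∑ m ∈ Finset.range n, 1 / ((m : ℝ) + 1)) * ∫ x, x ∂μ := by rw [Finset.sum_mul]
    _ ≤ _ := mul_le_mul_of_nonneg_right hharm (integral_nonneg_of_ae hnonneg)
end

section
/- For any MHR distribution D on [0,∞) with finite mean and any integers n ≥ 1 and m ≥ 2, letting M denote the maximum of n i.i.d. samples from D and α_m^{(M)} = inf{x : Pr[M ≤ x] ≥ 1 − 1/m} its (1 − 1/m)-quantile, the tail contribution satisfies E[M · 1{M > α_m^{(M)}}] ≤ 15·(ln m + ln n + 1)·E[D] / (2m). -/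
open MeasureTheory

/-- The mass of an interval is the integral of the density. -/
theorem tail_sub_tail_eq_integral {μ : Measure ℝ} [IsProbabilityMeasure μ] {f : ℝ → ℝ}
    (hf0 : ∀ x, 0 ≤ f x) (hfm : Measurable f)
    (hdens : μ = volume.withDensity fun x => ENNReal.ofReal (f x)) {a b : ℝ} (hab : a ≤ b) :
    μ.real (Set.Ioi a) - μ.real (Set.Ioi b) = ∫ x in a..b, f x := by
  have hsplit : μ.real (Set.Ioi a) = μ.real (Set.Ioc a b) + μ.real (Set.Ioi b) := by
    rw [← measureReal_union (Set.Ioc_disjoint_Ioi le_rfl) measurableSet_Ioi,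
      Set.Ioc_union_Ioi_eq_Ioi hab]
  have hIoc : μ.real (Set.Ioc a b) = ∫ x in Set.Ioc a b, f x := by
    rw [integral_eq_lintegral_of_nonneg_ae (Filter.Eventually.of_forall hf0)
      hfm.aestronglyMeasurable, measureReal_def]
    conv_lhs => rw [hdens]
    rw [withDensity_apply _ measurableSet_Ioc]
  rw [intervalIntegral.integral_of_le hab, ← hIoc, hsplit]
  ring

theorem integrable_density {μ : Measure ℝ} [IsProbabilityMeasure μ] {f : ℝ → ℝ}
    (hf0 : ∀ x, 0 ≤ f x) (hfm : Measurable f)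
    (hdens : μ = volume.withDensity fun x => ENNReal.ofReal (f x)) : Integrable f := by
  refine ⟨hfm.aestronglyMeasurable, ?_⟩
  rw [hasFiniteIntegral_iff_ofReal (Filter.Eventually.of_forall hf0), ← setLIntegral_univ,
    ← withDensity_apply _ MeasurableSet.univ, ← hdens]
  exact measure_lt_top _ _

theorem tail_eq_one_sub (μ : Measure ℝ) [IsProbabilityMeasure μ] (x : ℝ) :
    μ.real (Set.Ioi x) = 1 - μ.real (Set.Iic x) := by
  rw [← Set.compl_Iic, probReal_compl_eq_one_sub measurableSet_Iic]

theorem tail_antitone (μ : Measure ℝ) [IsProbabilityMeasure μ] :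
    Antitone fun x => μ.real (Set.Ioi x) :=
  fun _ _ h => measureReal_mono (Set.Ioi_subset_Ioi h)

theorem continuous_tail {μ : Measure ℝ} [IsProbabilityMeasure μ] {f : ℝ → ℝ}
    (hf0 : ∀ x, 0 ≤ f x) (hfm : Measurable f)
    (hdens : μ = volume.withDensity fun x => ENNReal.ofReal (f x)) :
    Continuous fun x => μ.real (Set.Ioi x) := by
  have hint := integrable_density hf0 hfm hdens
  have heq : (fun x => μ.real (Set.Ioi x)) =
      fun x => μ.real (Set.Ioi 0) - ∫ y in (0 : ℝ)..x, f y := by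
    funext x
    rcases le_total 0 x with h | h
    · rw [← tail_sub_tail_eq_integral hf0 hfm hdens h]; ring
    · rw [intervalIntegral.integral_symm, ← tail_sub_tail_eq_integral hf0 hfm hdens h]; ring
  rw [heq]
  exact continuous_const.sub
    (intervalIntegral.continuous_primitive (fun _ _ => hint.intervalIntegrable) 0)

/-- A monotone hazard rate makes the tail function submultiplicative. -/
theorem tail_add_le_mul {μ : Measure ℝ} [IsProbabilityMeasure μ] {f : ℝ → ℝ}
    (hf0 : ∀ x, 0 ≤ f x) (hfm : Measurable f)
    (hdens : μ = volume.withDensity fun x => ENNReal.ofReal (f x))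
    (hMHR : ∀ x y : ℝ, x ≤ y → (μ (Set.Iic y)).toReal < 1 →
      f x / (1 - (μ (Set.Iic x)).toReal) ≤ f y / (1 - (μ (Set.Iic y)).toReal))
    (hzero : μ.real (Set.Ioi 0) = 1) {x t : ℝ} (hx : 0 ≤ x) (ht : 0 ≤ t) :
    μ.real (Set.Ioi (x + t)) ≤ μ.real (Set.Ioi x) * μ.real (Set.Ioi t) := by
  have hcont := continuous_tail hf0 hfm hdens
  have hanti := tail_antitone μ
  have hint := integrable_density hf0 hfm hdens
  have hftc := fun {a b : ℝ} => @tail_sub_tail_eq_integral μ _ f hf0 hfm hdens a b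
  have hMHR' : ∀ a b : ℝ, a ≤ b → 0 < μ.real (Set.Ioi b) →
      f a / μ.real (Set.Ioi a) ≤ f b / μ.real (Set.Ioi b) := by
    intro a b hab hb
    rw [tail_eq_one_sub] at hb
    rw [tail_eq_one_sub, tail_eq_one_sub]
    exact hMHR a b hab (by rw [← measureReal_def]; linarith)
  have hG0 : ∀ y, 0 ≤ μ.real (Set.Ioi y) := fun y => measureReal_nonneg
  generalize hG : (fun y => μ.real (Set.Ioi y)) = G at hcont hanti
  have hGa : ∀ y, μ.real (Set.Ioi y) = G y := fun y => congrFun hG y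
  simp only [hGa] at *
  by_contra! hlt
  have hpos : 0 < G (x + t) := lt_of_le_of_lt (mul_nonneg (hG0 x) (hG0 t)) hlt
  let Z := Set.Icc 0 t ∩ {s | G (x + s) ≤ G x * G s}
  have hZ : IsCompact Z := isCompact_Icc.inter_right
    (isClosed_le (by fun_prop) (by fun_prop))
  have hZne : Z.Nonempty := ⟨0, ⟨le_rfl, ht⟩, by simp [hzero]⟩
  obtain ⟨⟨hs0, hst⟩, hs⟩ := hZ.sSup_mem hZne
  set s₀ := sSup Z with hs₀
  have hgt : ∀ s, s₀ < s → s ≤ t → G x * G s < G (x + s) := by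
    intro s h1 h2
    by_contra! h3
    exact absurd (le_csSup hZ.bddAbove (⟨⟨hs0.trans h1.le, h2⟩, h3⟩ : s ∈ Z)) (not_le.2 h1)
  have hle : ∫ s in s₀..t, G x * f s ≤ ∫ s in s₀..t, f (x + s) := by
    refine intervalIntegral.integral_mono_on_of_le_Ioo hst
      (hint.const_mul _).intervalIntegrable (hint.comp_add_left x).intervalIntegrable ?_
    intro s hs
    have hxs : 0 < G (x + s) := hpos.trans_le (hanti (by linarith [hs.2]))
    have hsp : 0 < G s := hxs.trans_le (hanti (by linarith))
    calc G x * f s = (G x * G s) * (f s / G s) := by field_simp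
      _ ≤ G (x + s) * (f (x + s) / G (x + s)) := by
          exact mul_le_mul (hgt s hs.1 hs.2.le).le (hMHR' s (x + s) (by linarith) hxs)
            (div_nonneg (hf0 s) hsp.le) hxs.le
      _ = f (x + s) := by field_simp
  rw [intervalIntegral.integral_comp_add_left (fun s => f s), intervalIntegral.integral_const_mul,
    ← hftc hst, ← hftc (by linarith)] at hle
  have hs' : G (x + s₀) ≤ G x * G s₀ := hs
  nlinarith

/-- If the tail is submultiplicative, the mean excess over `a` is at most the mean. -/
theorem integral_excess_le {μ : Measure ℝ} [IsProbabilityMeasure μ]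
    (hsupp : ∀ᵐ x ∂μ, 0 ≤ x) (hmean : Integrable id μ)
    (hsub : ∀ x t : ℝ, 0 ≤ x → 0 ≤ t →
      μ.real (Set.Ioi (x + t)) ≤ μ.real (Set.Ioi x) * μ.real (Set.Ioi t))
    {a : ℝ} (ha : 0 ≤ a) :
    ∫ x, max (x - a) 0 ∂μ ≤ μ.real (Set.Ioi a) * ∫ x, x ∂μ := by
  have hmean' : Integrable (fun x : ℝ => x) μ := hmean
  have hex : Integrable (fun x : ℝ => max (x - a) 0) μ :=
    (hmean'.sub (integrable_const a)).pos_part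
  rw [hex.integral_eq_integral_meas_lt (Filter.Eventually.of_forall fun x => le_max_right _ _),
    hmean'.integral_eq_integral_meas_lt hsupp, ← integral_const_mul]
  have hgi : IntegrableOn (fun t => μ.real (Set.Ioi t)) (Set.Ioi 0) := by
    refine ⟨(tail_antitone μ).measurable.aestronglyMeasurable, ?_⟩
    rw [hasFiniteIntegral_iff_ofReal (Filter.Eventually.of_forall fun x => measureReal_nonneg)]
    simp only [ofReal_measureReal (measure_ne_top μ _)]
    have := lintegral_eq_lintegral_meas_lt μ hsupp measurable_id.aemeasurable
    change ∫⁻ t in Set.Ioi 0, μ {x | t < x} < _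
    refine this.symm.trans_lt ?_
    exact (hasFiniteIntegral_iff_ofReal hsupp).1 hmean'.2
  refine integral_mono_of_nonneg (Filter.Eventually.of_forall fun x => measureReal_nonneg)
    (hgi.const_mul _) ?_
  filter_upwards [ae_restrict_mem measurableSet_Ioi] with t ht
  have ht' : (0 : ℝ) < t := ht
  have hset : {x : ℝ | t < max (x - a) 0} = Set.Ioi (a + t) := by
    ext x
    simp only [Set.mem_ofPred_eq, lt_max_iff, Set.mem_Ioi]
    constructor
    · rintro (h | h) <;> linarith
    · intro h; left; linarith
  rw [hset]
  exact hsub a t ha ht'.le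

/-- If the tail is submultiplicative, it decays exponentially at the scale of the mean. -/
theorem le_of_lt_tail {μ : Measure ℝ} [IsProbabilityMeasure μ]
    (hsupp : ∀ᵐ x ∂μ, 0 ≤ x) (hmean : Integrable id μ) (hE : 0 < ∫ x, x ∂μ)
    (hzero : μ.real (Set.Ioi 0) = 1)
    (hsub : ∀ x t : ℝ, 0 ≤ x → 0 ≤ t →
      μ.real (Set.Ioi (x + t)) ≤ μ.real (Set.Ioi x) * μ.real (Set.Ioi t))
    {x N : ℝ} (hN : 0 < N) (hx0 : 0 ≤ x) (hx : 1 / N < μ.real (Set.Ioi x)) :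
    x ≤ 3 * (∫ x, x ∂μ) * (Real.log N + 1) := by
  set E := ∫ x, x ∂μ
  have hmarkov : μ.real (Set.Ioi (3 * E)) ≤ 1 / 3 := by
    have h := mul_meas_ge_le_integral_of_nonneg (f := fun x : ℝ => x) hsupp hmean (3 * E)
    have h2 : μ.real (Set.Ioi (3 * E)) ≤ μ.real {x | 3 * E ≤ x} :=
      measureReal_mono fun y (hy : 3 * E < y) => hy.le
    change 3 * E * μ.real {x | 3 * E ≤ x} ≤ E at h
    have h3 : 3 * μ.real {x | 3 * E ≤ x} ≤ 1 := by
      by_contra! h4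
      nlinarith
    linarith
  have hpow : ∀ k : ℕ, μ.real (Set.Ioi (k * (3 * E))) ≤ (1 / 3) ^ k := by
    intro k
    induction k with
    | zero => simp [hzero]
    | succ k ih =>
      have := hsub (k * (3 * E)) (3 * E) (by positivity) (by positivity)
      rw [pow_succ, show ((k + 1 : ℕ) : ℝ) * (3 * E) = k * (3 * E) + 3 * E by push_cast; ring]
      exact this.trans (mul_le_mul ih hmarkov measureReal_nonneg (by positivity))
  set k := ⌊x / (3 * E)⌋₊
  have hk1 : k * (3 * E) ≤ x :=
    (le_div_iff₀ (by positivity)).1 (Nat.floor_le (by positivity))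
  have hk2 : x < (k + 1) * (3 * E) := (div_lt_iff₀ (by positivity)).1 (Nat.lt_floor_add_one _)
  have hlt : 1 / N < (1 / 3) ^ k := hx.trans_le ((tail_antitone μ hk1).trans (hpow k))
  have hlog : (k : ℝ) ≤ Real.log N := by
    rw [Real.le_log_iff_exp_le hN]
    have h3 : Real.exp k ≤ 3 ^ k := by
      rw [← Real.exp_one_pow]
      gcongr
      exact Real.exp_one_lt_three.le
    rw [one_div_pow] at hlt
    exact h3.trans ((one_div_lt_one_div hN (by positivity)).1 hlt).le
  nlinarith

/-- For any MHR distribution `D` on `[0,∞)` with finite mean, any `n ≥ 1` and `m ≥ 2`: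
if `M = max of n i.i.d. samples from D` (its law being the `n`-fold product measure pushed through
the pointwise supremum) and `α` is its `(1 − 1/m)`-quantile, then
`E[M·1{M > α}] ≤ 15·(ln m + ln n + 1)·E[D]/(2m)`. -/
theorem stmt11 (μ : Measure ℝ) [IsProbabilityMeasure μ] (hsupp : μ (Set.Iio 0) = 0)
    (hmean : Integrable id μ)
    (f : ℝ → ℝ) (hf0 : ∀ x, 0 ≤ f x) (hfm : Measurable f)
    (hdens : μ = MeasureTheory.volume.withDensity fun x => ENNReal.ofReal (f x))
    (hMHR : ∀ x y : ℝ, x ≤ y → (μ (Set.Iic y)).toReal < 1 →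
      f x / (1 - (μ (Set.Iic x)).toReal) ≤ f y / (1 - (μ (Set.Iic y)).toReal))
    (n m : ℕ) (hn : 1 ≤ n) (hm : 2 ≤ m)
    (Pn : Measure (Fin n → ℝ)) (hPn : Pn = Measure.pi fun _ : Fin n => μ)
    (α : ℝ)
    (hα : α = sInf {x : ℝ | 1 - 1 / (m : ℝ) ≤ (Pn {ω | (⨆ j, ω j) ≤ x}).toReal}) :
    (∫ ω, Set.indicator {ω' : Fin n → ℝ | α < ⨆ j, ω' j} (fun ω' => ⨆ j, ω' j) ω ∂Pn) ≤
      15 * (Real.log m + Real.log n + 1) * (∫ x, x ∂μ) / (2 * m) := by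

  have hE0 : ∀ᵐ x ∂μ, 0 ≤ x := by
    rw [ae_iff]
    simpa [Set.Iio] using hsupp
  have hzero : μ.real (Set.Ioi 0) = 1 := by
    have hac : μ ≪ volume := hdens ▸ withDensity_absolutelyContinuous _ _
    have h : μ (Set.Iic 0) = 0 := by
      rw [← measure_congr (hac.ae_eq Iio_ae_eq_Iic)]; exact hsupp
    rw [tail_eq_one_sub, measureReal_def, h]; simp
  have hE : 0 < ∫ x, x ∂μ := by
    rw [integral_pos_iff_support_of_nonneg_ae hE0 hmean]
    refine lt_of_lt_of_le ?_ (measure_mono (s := Set.Ioi 0) fun x hx => ne_of_gt hx)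
    rw [measureReal_def] at hzero
    by_contra! h
    simp [nonpos_iff_eq_zero.1 h] at hzero
  have hsub : ∀ x t : ℝ, 0 ≤ x → 0 ≤ t →
      μ.real (Set.Ioi (x + t)) ≤ μ.real (Set.Ioi x) * μ.real (Set.Ioi t) :=
    fun x t hx ht => tail_add_le_mul hf0 hfm hdens hMHR hzero hx ht
  have : NeZero n := ⟨by omega⟩
  have hm' : (2 : ℝ) ≤ m := by exact_mod_cast hm
  have hn' : (1 : ℝ) ≤ n := by exact_mod_cast hn
  have hPprob : IsProbabilityMeasure Pn := by rw [hPn]; infer_instance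
  have hMle : ∀ (x : ℝ) (ω : Fin n → ℝ), (⨆ j, ω j) ≤ x ↔ ∀ j, ω j ≤ x := fun x ω =>
    ciSup_le_iff (Set.finite_range ω).bddAbove
  have hcdf : ∀ x, Pn.real {ω | (⨆ j, ω j) ≤ x} = μ.real (Set.Iic x) ^ n := by
    intro x
    have hset : {ω : Fin n → ℝ | (⨆ j, ω j) ≤ x} = Set.univ.pi fun _ => Set.Iic x := by
      ext ω; simp [hMle, Pi.le_def]
    rw [hset, hPn, measureReal_def, Measure.pi_pi]
    simp [measureReal_def]
  have hF : ∀ x, μ.real (Set.Iic x) = 1 - μ.real (Set.Ioi x) := fun x => by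
    rw [tail_eq_one_sub]; ring
  have hcont := continuous_tail hf0 hfm hdens
  have hG0 : ∀ y, 0 ≤ μ.real (Set.Ioi y) := fun y => measureReal_nonneg
  have hG1 : ∀ y, μ.real (Set.Ioi y) ≤ 1 := fun y => measureReal_le_one
  simp only [← measureReal_def] at hα
  set S := {x : ℝ | 1 - 1 / (m : ℝ) ≤ Pn.real {ω | (⨆ j, ω j) ≤ x}} with hS
  have hSeq : S = {x : ℝ | 1 - 1 / (m : ℝ) ≤ (1 - μ.real (Set.Ioi x)) ^ n} := by
    simp only [hS, hcdf, hF]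
  have hinv : 1 / (m : ℝ) ≤ 1 / 2 := one_div_le_one_div_of_le (by norm_num) hm'
  have hinv0 : 0 < 1 / (m : ℝ) := by positivity
  have hS0 : ∀ x ∈ S, 0 ≤ x := by
    intro x hx
    by_contra! hlt
    rw [hSeq] at hx
    have h1 : μ.real (Set.Ioi x) = 1 :=
      le_antisymm (hG1 x) (hzero ▸ tail_antitone μ hlt.le)
    simp only [Set.mem_ofPred_eq, h1, sub_self, zero_pow (NeZero.ne n)] at hx
    linarith
  have hbdd : BddBelow S := ⟨0, hS0⟩
  have hSne : S.Nonempty := by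
    have htend : Filter.Tendsto (fun x => (ProbabilityTheory.cdf μ x) ^ n) Filter.atTop
        (nhds (1 ^ n)) := (ProbabilityTheory.tendsto_cdf_atTop μ).pow n
    rw [one_pow] at htend
    obtain ⟨x, hx⟩ := (htend.eventually (lt_mem_nhds (by linarith : 1 - 1 / (m : ℝ) < 1))).exists
    refine ⟨x, ?_⟩
    rw [ProbabilityTheory.cdf_eq_real] at hx
    simpa only [hS, Set.mem_ofPred_eq, hcdf] using hx.le
  have hSclosed : IsClosed S := by
    rw [hSeq]
    exact isClosed_le continuous_const (by fun_prop)
  have hαS : α ∈ S := hα ▸ hSclosed.csInf_mem hSne hbdd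
  have hα0 : 0 ≤ α := hS0 α hαS
  set q := μ.real (Set.Ioi α) with hq
  have hαq : 1 - 1 / (m : ℝ) ≤ (1 - q) ^ n := by rw [hSeq] at hαS; exact hαS
  have hnq : n * q ≤ 2 / m := by
    have h1 : 1 + n * q ≤ (1 + q) ^ n :=
      one_add_mul_le_pow (by linarith [hG0 α]) n
    have h2 : (1 + q) ^ n * (1 - q) ^ n ≤ 1 := by
      rw [← mul_pow]
      exact pow_le_one₀ (mul_nonneg (by linarith [hG0 α]) (by linarith [hG1 α]))
        (by nlinarith [hG0 α])
    have h3 : (1 + n * q) * (1 - 1 / (m : ℝ)) ≤ 1 :=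
      (mul_le_mul h1 hαq (by linarith) (by have := hG0 α; positivity)).trans h2
    have h4 : 0 ≤ n * q := mul_nonneg (by linarith) (hG0 α)
    rw [show (2 : ℝ) / m = 2 * (1 / m) by ring]
    nlinarith
  have hlogm : 0 ≤ Real.log m := Real.log_nonneg (by linarith)
  have hlogn : 0 ≤ Real.log n := Real.log_nonneg hn'
  have hαle : α ≤ 3 * (∫ x, x ∂μ) * (Real.log m + Real.log n + 1) := by
    refine le_of_forall_lt_imp_le_of_dense fun x hx => ?_
    rcases lt_or_ge x 0 with hx0 | hx0
    · exact hx0.le.trans (by positivity)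
    have hxS : x ∉ S := fun h => absurd (csInf_le hbdd h) (by rw [← hα]; exact not_le.2 hx)
    rw [hSeq, Set.mem_ofPred_eq, not_le] at hxS
    have hb : 1 + n * (-μ.real (Set.Ioi x)) ≤ (1 + -μ.real (Set.Ioi x)) ^ n :=
      one_add_mul_le_pow (by linarith [hG1 x]) n
    rw [← sub_eq_add_neg] at hb
    rw [← Real.log_mul (by positivity) (by positivity)]
    refine le_of_lt_tail hE0 hmean hE hzero hsub (by positivity) hx0 ?_
    rw [← div_div, div_lt_iff₀ (by positivity)]
    linarith
  have hMmeas : Measurable fun ω : Fin n → ℝ => ⨆ j, ω j :=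
    Measurable.iSup fun j => measurable_pi_apply j
  have hAmeas : MeasurableSet {ω : Fin n → ℝ | α < ⨆ j, ω j} :=
    measurableSet_lt measurable_const hMmeas
  have hAle : Pn.real {ω : Fin n → ℝ | α < ⨆ j, ω j} ≤ 1 / m := by
    have hc : {ω : Fin n → ℝ | α < ⨆ j, ω j} = {ω | (⨆ j, ω j) ≤ α}ᶜ := by
      ext ω; simp
    rw [hc, probReal_compl_eq_one_sub (measurableSet_le hMmeas measurable_const)]
    have : 1 - 1 / (m : ℝ) ≤ Pn.real {ω | (⨆ j, ω j) ≤ α} := hαS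
    linarith
  have hmp : ∀ j, MeasurePreserving (fun ω : Fin n → ℝ => ω j) Pn μ := fun j => by
    rw [hPn]; exact measurePreserving_eval (fun _ : Fin n => μ) j
  have hex : Integrable (fun x : ℝ => max (x - α) 0) μ :=
    ((show Integrable (fun x : ℝ => x) μ from hmean).sub (integrable_const α)).pos_part
  have hexj : ∀ j, Integrable (fun ω : Fin n → ℝ => max (ω j - α) 0) Pn := fun j =>
    (hmp j).integrable_comp_of_integrable hex
  have hexint : ∀ j, ∫ ω, max (ω j - α) 0 ∂Pn = ∫ x, max (x - α) 0 ∂μ := fun j => by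
    rw [← (hmp j).map_eq, integral_map (hmp j).measurable.aemeasurable]
    rw [(hmp j).map_eq]
    exact hex.aestronglyMeasurable
  have hind : Integrable (Set.indicator {ω : Fin n → ℝ | α < ⨆ j, ω j} fun _ => α) Pn :=
    (integrable_const α).indicator hAmeas
  calc _ ≤ ∫ ω, (Set.indicator {ω : Fin n → ℝ | α < ⨆ j, ω j} (fun _ => α) ω
          + ∑ j, max (ω j - α) 0) ∂Pn := by
        refine integral_mono_of_nonneg (Filter.Eventually.of_forall fun ω => ?_)
          (hind.add (integrable_finsetSum _ fun j _ => hexj j))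
          (Filter.Eventually.of_forall fun ω => ?_)
        · exact Set.indicator_nonneg (fun ω hω => hα0.trans (le_of_lt hω)) ω
        · have hnn : ∀ j ∈ Finset.univ, 0 ≤ max (ω j - α) 0 := fun j _ => le_max_right _ _
          by_cases hω : α < ⨆ j, ω j
          · simp only [Set.indicator, Set.mem_ofPred_eq, hω, if_true]
            refine (hMle _ ω).2 fun j => ?_
            have := Finset.single_le_sum hnn (Finset.mem_univ j)
            linarith [le_max_left (ω j - α) 0]
          · simp only [Set.indicator, Set.mem_ofPred_eq, hω, if_false, zero_add]
            exact Finset.sum_nonneg hnn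
    _ = α * Pn.real {ω : Fin n → ℝ | α < ⨆ j, ω j} + n * ∫ x, max (x - α) 0 ∂μ := by
        rw [integral_add hind (integrable_finsetSum _ fun j _ => hexj j),
          integral_indicator_const _ hAmeas, integral_finsetSum _ fun j _ => hexj j]
        simp only [hexint, Finset.sum_const, Finset.card_univ, Fintype.card_fin, smul_eq_mul,
          nsmul_eq_mul]
        ring
    _ ≤ 3 * (∫ x, x ∂μ) * (Real.log m + Real.log n + 1) * (1 / m)
          + 2 / m * ∫ x, x ∂μ := by
        gcongr ?_ + ?_
        · exact mul_le_mul hαle hAle measureReal_nonneg (by positivity)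
        · calc n * ∫ x, max (x - α) 0 ∂μ ≤ n * (q * ∫ x, x ∂μ) := by
                gcongr
                exact integral_excess_le hE0 hmean hsub hα0
            _ = (n * q) * ∫ x, x ∂μ := by ring
            _ ≤ _ := by gcongr
    _ ≤ _ := by
        rw [← sub_nonneg]
        have : 15 * (Real.log m + Real.log n + 1) * (∫ x, x ∂μ) / (2 * m) -
            (3 * (∫ x, x ∂μ) * (Real.log m + Real.log n + 1) * (1 / m) + 2 / m * ∫ x, x ∂μ)
            = (∫ x, x ∂μ) * (9 * (Real.log m + Real.log n) + 5) / (2 * m) := by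
          field_simp; ring
        rw [this]
        positivity
end
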